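/- Let n ≥ 2 be an integer, p₀, p ∈ Sⁿ with p ≠ p₀, and a ∈ (0,π), and suppose p ∈ B(p₀,a), i.e. arccos⟨p₀,p⟩ < a. Then (1/|B_a|) · ∫_{q ∈ B(p₀,a)} g_n(‖p − q‖) dσ(q) = −(B_{cos²(a/2)}(n/2,n/2)/B_{sin²(a/2)}(n/2,n/2)) · (g_n(‖p + p₀‖) + K(n,π−a)), where |B_a| = V_{n−1}·∫₀^a sin^{n−1}r dr. -/

import Mathlib

open MeasureTheory Real Filter
open scoped RealInnerProductSpace

noncomputable def poch (x : ℝ) (k : ℕ) : ℝ := ∏ i ∈ Finset.range k, (x + i)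

noncomputable def incBeta (x α β : ℝ) : ℝ := ∫ t in (0:ℝ)..x, t ^ (α - 1) * (1 - t) ^ (β - 1)

noncomputable def sphereVol (n : ℕ) : ℝ :=
  2 * Real.pi ^ (((n : ℝ) + 1) / 2) / Real.Gamma (((n : ℝ) + 1) / 2)

noncomputable def green (n : ℕ) (t : ℝ) : ℝ :=
  2 / (n * sphereVol n) * ∑' k : ℕ,
    poch n k / (((k : ℝ) + 1) * poch ((n : ℝ) / 2 + 1) k) *
      ((1 - t ^ 2 / 4) ^ (k + 1)
        - incBeta 1 ((n : ℝ) / 2) ((n : ℝ) / 2 + k + 1) / incBeta 1 ((n : ℝ) / 2) ((n : ℝ) / 2))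

noncomputable def Kfun (n : ℕ) (a : ℝ) : ℝ :=
  2 / (n * sphereVol n) * ∑' k : ℕ,
    poch n k / (poch ((n : ℝ) / 2 + 1) k * ((k : ℝ) + 1)) *
      (incBeta (Real.sin (a / 2) ^ 2) ((n : ℝ) / 2 + k + 1) ((n : ℝ) / 2) /
        incBeta (Real.sin (a / 2) ^ 2) ((n : ℝ) / 2) ((n : ℝ) / 2))

noncomputable def ballVol (n : ℕ) (a : ℝ) : ℝ :=
  sphereVol (n - 1) * ∫ r in (0:ℝ)..a, Real.sin r ^ (n - 1)

noncomputable def sphereMeasure (n : ℕ) :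
    Measure (Metric.sphere (0 : EuclideanSpace ℝ (Fin (n + 1))) 1) :=
  (volume : Measure (EuclideanSpace ℝ (Fin (n + 1)))).toSphere

theorem lintegral_eq_lintegral_toSphere {E : Type*} [NormedAddCommGroup E] [NormedSpace ℝ E]
    [MeasurableSpace E] [BorelSpace E] [FiniteDimensional ℝ E] [Nontrivial E] (μ : Measure E)
    [μ.IsAddHaarMeasure] {F : E → ENNReal} (hF : Measurable F) :
    ∫⁻ x, F x ∂μ = ∫⁻ q, (∫⁻ r in Set.Ioi (0 : ℝ),
      ENNReal.ofReal (r ^ (Module.finrank ℝ E - 1)) * F (r • (q : E))) ∂μ.toSphere := by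
  have h1 : ∫⁻ x, F x ∂μ = ∫⁻ x : ({0}ᶜ : Set E), F x ∂(μ.comap (↑)) := by
    rw [lintegral_subtype_comap (measurableSet_singleton _).compl, restrict_compl_singleton]
  have h2 := (μ.measurePreserving_homeomorphUnitSphereProd).symm
    (homeomorphUnitSphereProd E).toMeasurableEquiv
  have hm : Measurable fun y : Metric.sphere (0 : E) 1 × Set.Ioi (0 : ℝ) =>
      F (y.2.1 • (y.1 : E)) := by fun_prop
  rw [h1, ← h2.lintegral_comp (f := fun x : ({0}ᶜ : Set E) => F x)
    (hF.comp measurable_subtype_coe)]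
  have h3 : ∀ y : Metric.sphere (0 : E) 1 × Set.Ioi (0 : ℝ),
      F ((homeomorphUnitSphereProd E).toMeasurableEquiv.symm y).1 = F (y.2.1 • (y.1 : E)) :=
    fun y => rfl
  simp_rw [h3]
  rw [lintegral_prod _ hm.aemeasurable]
  refine lintegral_congr fun q => ?_
  rw [Measure.volumeIoiPow, lintegral_withDensity_eq_lintegral_mul _ (by fun_prop) (by fun_prop)]
  exact lintegral_subtype_comap measurableSet_Ioi
    (fun r : ℝ => ENNReal.ofReal (r ^ (Module.finrank ℝ E - 1)) * F (r • (q : E)))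

theorem lintegral_comp_norm_eq {E : Type*} [NormedAddCommGroup E] [NormedSpace ℝ E]
    [MeasurableSpace E] [BorelSpace E] [FiniteDimensional ℝ E] [Nontrivial E] (μ : Measure E)
    [μ.IsAddHaarMeasure] {h : ℝ → ENNReal} (hh : Measurable h) :
    ∫⁻ x, h ‖x‖ ∂μ = μ.toSphere Set.univ * ∫⁻ r in Set.Ioi (0 : ℝ),
      ENNReal.ofReal (r ^ (Module.finrank ℝ E - 1)) * h r := by
  rw [lintegral_eq_lintegral_toSphere μ (F := fun x => h ‖x‖) (hh.comp measurable_norm), mul_comm, ← lintegral_const]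
  refine lintegral_congr fun q => setLIntegral_congr_fun measurableSet_Ioi fun r hr => ?_
  simp [norm_smul, abs_of_pos (Set.mem_Ioi.1 hr)]

theorem sphereMeasure_univ (n : ℕ) :
    sphereMeasure n Set.univ = ENNReal.ofReal (sphereVol n) := by
  have h2 : (Real.Gamma (((n : ℝ) + 1) / 2)) ≠ 0 := (Real.Gamma_pos_of_pos (by positivity)).ne'
  rw [sphereMeasure, Measure.toSphere_apply_univ, EuclideanSpace.volume_ball,
    finrank_euclideanSpace_fin, ENNReal.ofReal_one, one_pow, one_mul, Fintype.card_fin,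
    ← ENNReal.ofReal_natCast, ← ENNReal.ofReal_mul (by positivity), sphereVol]
  congr 1
  push_cast
  rw [Real.Gamma_add_one (by positivity), Real.sqrt_eq_rpow, ← Real.rpow_natCast,
    ← Real.rpow_mul Real.pi_pos.le]
  push_cast
  field_simp

/-- The Euclidean space of dimension `n + 1` splits as a line and its orthogonal complement. -/
theorem lintegral_inner_norm {n : ℕ} (p : EuclideanSpace ℝ (Fin (n + 1))) (hp : ‖p‖ = 1)
    {F : ℝ → ℝ → ENNReal} (hF : Measurable (Function.uncurry F)) :
    ∫⁻ x : EuclideanSpace ℝ (Fin (n + 1)), F ⟪p, x⟫ ‖x‖ =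
      ∫⁻ s : ℝ, ∫⁻ z : EuclideanSpace ℝ (Fin n), F s √(s ^ 2 + ‖z‖ ^ 2) := by
  obtain ⟨b, hb⟩ := Orthonormal.exists_orthonormalBasis_extension_of_card_eq (𝕜 := ℝ)
    (E := EuclideanSpace ℝ (Fin (n + 1))) (ι := Fin (n + 1)) (by simp)
    (v := fun _ => p) (s := {0}) (by
      refine ⟨fun i => by simpa using hp, fun i j hij => (hij (Subsingleton.elim _ _)).elim⟩)
  have hb0 : b 0 = p := hb 0 rfl
  have hG : Measurable fun x : EuclideanSpace ℝ (Fin (n + 1)) => F (x 0) ‖x‖ := by fun_prop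
  have e1 : ∫⁻ x : EuclideanSpace ℝ (Fin (n + 1)), F ⟪p, x⟫ ‖x‖ =
      ∫⁻ x : EuclideanSpace ℝ (Fin (n + 1)), F (x 0) ‖x‖ := by
    rw [← b.measurePreserving_repr.lintegral_comp hG]
    simp [OrthonormalBasis.repr_apply_apply, hb0]
  have e2 := (PiLp.volume_preserving_toLp (Fin (n + 1))).lintegral_comp hG
  have e3 := (volume_preserving_piFinSuccAbove (fun _ : Fin (n + 1) => ℝ) 0).symm
    (MeasurableEquiv.piFinSuccAbove (fun _ => ℝ) 0)
  rw [e1, ← e2, ← e3.lintegral_comp (by fun_prop), Measure.volume_eq_prod,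
    lintegral_prod _ (by fun_prop)]
  refine lintegral_congr fun s => ?_
  rw [← (PiLp.volume_preserving_toLp (Fin n)).lintegral_comp (by fun_prop)]
  refine lintegral_congr fun z => ?_
  simp [EuclideanSpace.norm_eq, Fin.sum_univ_succ, Real.sq_sqrt, Finset.sum_nonneg, sq_nonneg,
    MeasurableEquiv.piFinSuccAbove]

theorem lintegral_sphere_inner {n : ℕ} (hn : 2 ≤ n)
    (p : Metric.sphere (0 : EuclideanSpace ℝ (Fin (n + 1))) 1) {f : ℝ → ENNReal}
    (hf : Measurable f) :
    ∫⁻ q : Metric.sphere (0 : EuclideanSpace ℝ (Fin (n + 1))) 1,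
        f ⟪(p : EuclideanSpace ℝ (Fin (n + 1))), (q : EuclideanSpace ℝ (Fin (n + 1)))⟫
          ∂(sphereMeasure n) =
      ENNReal.ofReal (sphereVol (n - 1)) *
        ∫⁻ φ in Set.Ioo 0 π, ENNReal.ofReal (Real.sin φ ^ (n - 1)) * f (Real.cos φ) := by
  obtain ⟨m, rfl⟩ : ∃ m, n = m + 2 := ⟨n - 2, by omega⟩
  have hnp : ‖(p : EuclideanSpace ℝ (Fin (m + 2 + 1)))‖ = 1 := by simp
  set C : ENNReal := ∫⁻ r in Set.Ioi (0 : ℝ),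
    ENNReal.ofReal (r ^ (m + 2)) * ENNReal.ofReal (Real.exp (-r ^ 2)) with hC
  have hC0 : C ≠ 0 := by
    rw [hC, ← pos_iff_ne_zero, setLIntegral_pos_iff (by fun_prop)]
    have : Set.Ioi (0 : ℝ) ⊆ (Function.support fun r : ℝ =>
        ENNReal.ofReal (r ^ (m + 2)) * ENNReal.ofReal (Real.exp (-r ^ 2))) ∩ Set.Ioi 0 := by
      intro r hr
      have hr' : (0 : ℝ) < r := hr
      refine ⟨?_, hr⟩
      have h1 : 0 < r ^ (m + 2) := by positivity
      simp [h1, Real.exp_pos]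
    exact lt_of_lt_of_le (by simp) (measure_mono this)
  have hCtop : C ≠ ⊤ := by
    have h1 := integrable_rpow_mul_exp_neg_mul_sq (b := 1) one_pos (s := ((m + 2 : ℕ) : ℝ))
      (by push_cast; linarith [(Nat.cast_nonneg m : (0 : ℝ) ≤ m)])
    have h2 := (h1.integrableOn (s := Set.Ioi (0 : ℝ))).lintegral_lt_top
    refine ne_of_lt (lt_of_le_of_lt (le_of_eq ?_) h2)
    refine setLIntegral_congr_fun measurableSet_Ioi fun r hr => ?_
    have hr' : (0 : ℝ) < r := hr
    simp only [Real.rpow_natCast, neg_mul, one_mul]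
    rw [ENNReal.ofReal_mul (by positivity)]
  have hF : Measurable (Function.uncurry fun s t : ℝ =>
      f (s / t) * ENNReal.ofReal (Real.exp (-t ^ 2))) := by fun_prop
  have key := lintegral_inner_norm (p : EuclideanSpace ℝ (Fin (m + 2 + 1))) hnp hF
  have lhs : ∫⁻ x : EuclideanSpace ℝ (Fin (m + 2 + 1)),
      f (⟪(p : EuclideanSpace ℝ (Fin (m + 2 + 1))), x⟫ / ‖x‖) * ENNReal.ofReal (Real.exp (-‖x‖ ^ 2))
      = (∫⁻ q : Metric.sphere (0 : EuclideanSpace ℝ (Fin (m + 2 + 1))) 1,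
        f ⟪(p : EuclideanSpace ℝ (Fin (m + 2 + 1))), (q : EuclideanSpace ℝ (Fin (m + 2 + 1)))⟫
          ∂(sphereMeasure (m + 2))) * C := by
    rw [lintegral_eq_lintegral_toSphere volume (by fun_prop), sphereMeasure,
      ← lintegral_mul_const _ (by fun_prop)]
    refine lintegral_congr fun q => ?_
    rw [hC, ← lintegral_const_mul _ (by fun_prop)]
    refine setLIntegral_congr_fun measurableSet_Ioi fun r hr => ?_
    have hr' : (0 : ℝ) < r := hr
    simp only [inner_smul_right, norm_smul, norm_eq_of_mem_sphere, Real.norm_eq_abs,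
      abs_of_pos hr', mul_one, finrank_euclideanSpace_fin, Nat.add_sub_cancel]
    rw [mul_div_cancel_left₀ _ hr'.ne']
    ring
  have rhs : ∫⁻ s : ℝ, ∫⁻ z : EuclideanSpace ℝ (Fin (m + 2)),
      f (s / √(s ^ 2 + ‖z‖ ^ 2)) * ENNReal.ofReal (Real.exp (-√(s ^ 2 + ‖z‖ ^ 2) ^ 2))
      = (ENNReal.ofReal (sphereVol (m + 1)) *
        ∫⁻ φ in Set.Ioo 0 π, ENNReal.ofReal (Real.sin φ ^ (m + 1)) * f (Real.cos φ)) * C := by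
    have h1 : ∀ s : ℝ, ∫⁻ z : EuclideanSpace ℝ (Fin (m + 2)),
        f (s / √(s ^ 2 + ‖z‖ ^ 2)) * ENNReal.ofReal (Real.exp (-√(s ^ 2 + ‖z‖ ^ 2) ^ 2)) =
        ENNReal.ofReal (sphereVol (m + 1)) * ∫⁻ r, (Set.Ioi (0 : ℝ)).indicator
          (fun r => ENNReal.ofReal (r ^ (m + 1)) *
          (f (s / √(s ^ 2 + r ^ 2)) * ENNReal.ofReal (Real.exp (-√(s ^ 2 + r ^ 2) ^ 2)))) r := by
      intro s
      rw [lintegral_comp_norm_eq volume (h := fun r => f (s / √(s ^ 2 + r ^ 2)) *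
        ENNReal.ofReal (Real.exp (-√(s ^ 2 + r ^ 2) ^ 2))) (by fun_prop),
        ← sphereMeasure_univ, lintegral_indicator measurableSet_Ioi, finrank_euclideanSpace_fin]
      rfl
    have hm : Measurable fun y : ℝ × ℝ => (Set.Ioi (0 : ℝ)).indicator
          (fun r => ENNReal.ofReal (r ^ (m + 1)) * (f (y.1 / √(y.1 ^ 2 + r ^ 2)) *
            ENNReal.ofReal (Real.exp (-√(y.1 ^ 2 + r ^ 2) ^ 2)))) y.2 := by
      have : Measurable fun y : ℝ × ℝ => (ENNReal.ofReal (y.2 ^ (m + 1)) *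
          (f (y.1 / √(y.1 ^ 2 + y.2 ^ 2)) *
            ENNReal.ofReal (Real.exp (-√(y.1 ^ 2 + y.2 ^ 2) ^ 2)))) := by fun_prop
      exact this.indicator (measurableSet_Ioi.preimage measurable_snd)
    simp_rw [h1]
    rw [lintegral_const_mul _ hm.lintegral_prod_right', mul_assoc, ← lintegral_prod _ hm.aemeasurable,
      ← Measure.volume_eq_prod, ← lintegral_comp_polarCoord_symm, polarCoord_target,
      Measure.volume_eq_prod, ← Measure.prod_restrict, lintegral_prod]
    · congr 1
      rw [hC, mul_comm, ← lintegral_mul_const _ (by fun_prop)]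
      refine setLIntegral_congr_fun measurableSet_Ioi fun r hr => ?_
      have hr' : (0 : ℝ) < r := hr
      have hsq : ∀ φ : ℝ, √((r * Real.cos φ) ^ 2 + (r * Real.sin φ) ^ 2) = r := fun φ => by
        rw [mul_pow, mul_pow, ← mul_add, Real.cos_sq_add_sin_sq, mul_one, Real.sqrt_sq hr'.le]
      rw [← lintegral_const_mul _ (by fun_prop), ← lintegral_indicator measurableSet_Ioo,
        ← lintegral_indicator measurableSet_Ioo]
      refine lintegral_congr fun φ => ?_
      simp only [polarCoord_symm_apply, Set.indicator, hsq, smul_eq_mul, Set.mem_Ioo, Set.mem_Ioi]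
      by_cases h0 : 0 < φ ∧ φ < π
      · have hs := Real.sin_pos_of_pos_of_lt_pi h0.1 h0.2
        rw [if_pos ⟨by linarith [Real.pi_pos], h0.2⟩, if_pos (by positivity), if_pos h0,
          mul_div_cancel_left₀ _ hr'.ne', mul_pow, ENNReal.ofReal_mul (by positivity),
          pow_succ r (m + 1), ENNReal.ofReal_mul (by positivity)]
        ring
      · rw [if_neg h0]
        split_ifs with h2 h3
        · have : Real.sin φ ≤ 0 := Real.sin_nonpos_of_nonpos_of_neg_pi_le
            (not_lt.1 fun h => h0 ⟨h, h2.2⟩) h2.1.le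
          nlinarith
        · simp
        · simp
    · have h2 : Measurable fun y : ℝ × ℝ => polarCoord.symm y := by
        simp only [polarCoord_symm_apply]; fun_prop
      exact ((ENNReal.measurable_ofReal.comp measurable_fst).smul (hm.comp h2)).aemeasurable
  rw [lhs, rhs] at key
  exact (ENNReal.mul_left_inj hC0 hCtop).1 key

theorem map_arccos_inner_sphereMeasure {n : ℕ} (hn : 2 ≤ n)
    (p : Metric.sphere (0 : EuclideanSpace ℝ (Fin (n + 1))) 1) :
    (sphereMeasure n).map (fun q : Metric.sphere (0 : EuclideanSpace ℝ (Fin (n + 1))) 1 => Real.arccos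
        ⟪(p : EuclideanSpace ℝ (Fin (n + 1))), (q : EuclideanSpace ℝ (Fin (n + 1)))⟫) =
      ENNReal.ofReal (sphereVol (n - 1)) • (volume.restrict (Set.Ioo 0 π)).withDensity
        (fun φ => ENNReal.ofReal (Real.sin φ ^ (n - 1))) := by
  ext s hs
  rw [← lintegral_indicator_one hs,
    lintegral_map (measurable_one.indicator hs) (by fun_prop),
    lintegral_sphere_inner hn p (f := fun y => s.indicator 1 (Real.arccos y))
      ((measurable_one.indicator hs).comp Real.continuous_arccos.measurable),
    Measure.smul_apply, smul_eq_mul, withDensity_apply _ hs, ← lintegral_indicator hs]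
  congr 1
  refine setLIntegral_congr_fun measurableSet_Ioo fun φ hφ => ?_
  have e := Real.arccos_cos hφ.1.le hφ.2.le
  by_cases h : φ ∈ s <;> simp [Set.indicator, e, h]

theorem sphereVol_pos (n : ℕ) : 0 < sphereVol n := by
  have : 0 < Real.Gamma (((n : ℝ) + 1) / 2) := Real.Gamma_pos_of_pos (by positivity)
  unfold sphereVol
  positivity

theorem setIntegral_arccos_inner_sphere {n : ℕ} (hn : 2 ≤ n)
    (p : Metric.sphere (0 : EuclideanSpace ℝ (Fin (n + 1))) 1) {s : Set ℝ} (hs : MeasurableSet s)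
    {g : ℝ → ℝ} (hg : Measurable g) :
    ∫ q in {q : Metric.sphere (0 : EuclideanSpace ℝ (Fin (n + 1))) 1 | Real.arccos
        ⟪(p : EuclideanSpace ℝ (Fin (n + 1))), (q : EuclideanSpace ℝ (Fin (n + 1)))⟫ ∈ s},
        g (Real.arccos
          ⟪(p : EuclideanSpace ℝ (Fin (n + 1))), (q : EuclideanSpace ℝ (Fin (n + 1)))⟫)
          ∂(sphereMeasure n) =
      sphereVol (n - 1) * ∫ φ in s ∩ Set.Ioo 0 π, Real.sin φ ^ (n - 1) * g φ := by
  have hm : Measurable fun q : Metric.sphere (0 : EuclideanSpace ℝ (Fin (n + 1))) 1 =>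
      Real.arccos ⟪(p : EuclideanSpace ℝ (Fin (n + 1))), (q : EuclideanSpace ℝ (Fin (n + 1)))⟫ := by
    fun_prop
  have h1 := setIntegral_map (μ := sphereMeasure n) hs hg.aestronglyMeasurable hm.aemeasurable
  rw [map_arccos_inner_sphereMeasure hn, Measure.restrict_smul, integral_smul_measure,
    ENNReal.toReal_ofReal (sphereVol_pos _).le, restrict_withDensity hs,
    Measure.restrict_restrict hs] at h1
  have h2 : ∀ᵐ φ ∂(volume.restrict (s ∩ Set.Ioo 0 π)),
      ENNReal.ofReal (Real.sin φ ^ (n - 1)) < ⊤ := by simp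
  rw [integral_withDensity_eq_integral_toReal_smul (by fun_prop) h2] at h1
  refine Eq.trans h1.symm ?_
  rw [smul_eq_mul]
  congr 1
  refine setIntegral_congr_fun (hs.inter measurableSet_Ioo) fun φ hφ => ?_
  have := Real.sin_pos_of_pos_of_lt_pi hφ.2.1 hφ.2.2
  simp only [smul_eq_mul]
  rw [ENNReal.toReal_ofReal (by positivity)]

/-- The integral of `sin (φ / 2) ^ (2 * m) * sin φ ^ (n - 1)` over `[0, b]`, which is
`2 ^ (n - 1)` times the incomplete beta function with parameters `n / 2 + m` and `n / 2`. -/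
noncomputable def sinMoment (n m : ℕ) (b : ℝ) : ℝ :=
  ∫ φ in (0 : ℝ)..b, Real.sin φ ^ (n - 1) * (Real.sin (φ / 2) ^ 2) ^ m

theorem sin_eq_two_mul_half (φ : ℝ) : Real.sin φ = 2 * Real.sin (φ / 2) * Real.cos (φ / 2) := by
  rw [← Real.sin_two_mul]; ring_nf

theorem hasDerivAt_sin_half_sq (φ : ℝ) :
    HasDerivAt (fun φ => Real.sin (φ / 2) ^ 2) (Real.sin φ / 2) φ := by
  have := ((Real.hasDerivAt_sin (φ / 2)).comp φ ((hasDerivAt_id φ).div_const 2)).pow 2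
  refine this.congr_deriv ?_
  rw [sin_eq_two_mul_half φ]
  simp
  ring

theorem incBeta_sin_half_sq {n : ℕ} (hn : 2 ≤ n) (m : ℕ) {b : ℝ} (hb : b ∈ Set.Icc 0 π) :
    incBeta (Real.sin (b / 2) ^ 2) ((n : ℝ) / 2 + m) ((n : ℝ) / 2) =
      sinMoment n m b / 2 ^ (n - 1) := by
  have hn' : (2 : ℝ) ≤ n := by exact_mod_cast hn
  have hc : Continuous fun t : ℝ => t ^ ((n : ℝ) / 2 + m - 1) * (1 - t) ^ ((n : ℝ) / 2 - 1) := by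
    refine (Real.continuous_rpow_const ?_).mul
      ((Real.continuous_rpow_const ?_).comp (by fun_prop))
    · have : (0 : ℝ) ≤ m := Nat.cast_nonneg m
      linarith
    · linarith
  have h := intervalIntegral.integral_comp_mul_deriv (a := 0) (b := b)
    (f := fun φ => Real.sin (φ / 2) ^ 2) (f' := fun φ => Real.sin φ / 2)
    (g := fun t : ℝ => t ^ ((n : ℝ) / 2 + m - 1) * (1 - t) ^ ((n : ℝ) / 2 - 1))
    (fun φ _ => hasDerivAt_sin_half_sq φ) (by fun_prop) hc
  simp only [zero_div, Real.sin_zero, ne_eq, OfNat.ofNat_ne_zero, not_false_eq_true, zero_pow] at h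
  rw [incBeta, ← h, sinMoment, ← intervalIntegral.integral_div]
  refine intervalIntegral.integral_congr fun φ hφ => ?_
  rw [Set.uIcc_of_le hb.1] at hφ
  have hs : 0 ≤ Real.sin (φ / 2) := Real.sin_nonneg_of_nonneg_of_le_pi (by linarith [hφ.1])
    (by linarith [hφ.2, hb.2, hφ.1])
  have hcs : 0 ≤ Real.cos (φ / 2) := Real.cos_nonneg_of_neg_pi_div_two_le_of_le
    (by linarith [hφ.1, Real.pi_pos]) (by linarith [hφ.2, hb.2])
  obtain ⟨k, rfl⟩ : ∃ k, n = k + 2 := ⟨n - 2, by omega⟩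
  have e1 : (Real.sin (φ / 2) ^ 2) ^ (((k + 2 : ℕ) : ℝ) / 2 + m - 1) =
      Real.sin (φ / 2) ^ (k + 2 * m) := by
    rw [← Real.rpow_natCast, ← Real.rpow_mul hs, ← Real.rpow_natCast]
    congr 1; push_cast; ring
  have e2 : (1 - Real.sin (φ / 2) ^ 2) ^ (((k + 2 : ℕ) : ℝ) / 2 - 1) = Real.cos (φ / 2) ^ k := by
    rw [← Real.cos_sq', ← Real.rpow_natCast, ← Real.rpow_mul hcs, ← Real.rpow_natCast]
    congr 1; push_cast; ring
  simp only [Function.comp]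
  rw [e1, e2, sin_eq_two_mul_half φ, show k + 2 - 1 = k + 1 by omega]
  field_simp
  ring

theorem incBeta_one_comm (α β : ℝ) : incBeta 1 α β = incBeta 1 β α := by
  unfold incBeta
  have := intervalIntegral.integral_comp_sub_left (a := 0) (b := 1)
    (fun t : ℝ => t ^ (β - 1) * (1 - t) ^ (α - 1)) 1
  simp only [sub_self, sub_zero] at this
  rw [← this]
  refine intervalIntegral.integral_congr fun t _ => ?_
  simp only [sub_sub_cancel]
  ring

theorem incBeta_one {n : ℕ} (hn : 2 ≤ n) (m : ℕ) :
    incBeta 1 ((n : ℝ) / 2) ((n : ℝ) / 2 + m) = sinMoment n m π / 2 ^ (n - 1) := by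
  rw [incBeta_one_comm, ← incBeta_sin_half_sq hn m ⟨Real.pi_pos.le, le_rfl⟩]
  simp

theorem sinMoment_pos (n m : ℕ) {b : ℝ} (hb : 0 < b) (hb' : b ≤ π) : 0 < sinMoment n m b := by
  refine intervalIntegral.intervalIntegral_pos_of_pos_on
    (Continuous.intervalIntegrable (by fun_prop) _ _) (fun φ hφ => ?_) hb
  have h1 := Real.sin_pos_of_pos_of_lt_pi hφ.1 (by linarith [hφ.2])
  have h2 := Real.sin_pos_of_pos_of_lt_pi (x := φ / 2) (by linarith [hφ.1])
    (by linarith [hφ.2, hφ.1])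
  positivity

theorem sinMoment_pi_succ {n : ℕ} (hn : 2 ≤ n) (m : ℕ) :
    ((n : ℝ) + m) * sinMoment n (m + 1) π = ((n : ℝ) / 2 + m) * sinMoment n m π := by
  have h : ∀ φ ∈ Set.uIcc 0 π, HasDerivAt
      (fun φ => (Real.sin (φ / 2) ^ 2) ^ m * Real.sin φ ^ n)
      ((2 * m + n) * (Real.sin φ ^ (n - 1) * (Real.sin (φ / 2) ^ 2) ^ m) -
        (2 * m + 2 * n) * (Real.sin φ ^ (n - 1) * (Real.sin (φ / 2) ^ 2) ^ (m + 1))) φ := by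
    intro φ _
    refine (((hasDerivAt_sin_half_sq φ).pow m).mul ((Real.hasDerivAt_sin φ).pow n)).congr_deriv ?_
    obtain ⟨k, rfl⟩ : ∃ k, n = k + 1 := ⟨n - 1, by omega⟩
    have hc : Real.cos φ = 1 - 2 * Real.sin (φ / 2) ^ 2 := by
      rw [Real.sin_sq_eq_half_sub, mul_div_cancel₀ _ two_ne_zero]; ring
    have hs : Real.sin φ ^ 2 = 4 * Real.sin (φ / 2) ^ 2 * (1 - Real.sin (φ / 2) ^ 2) := by
      rw [sin_eq_two_mul_half φ, ← Real.cos_sq']; ring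
    simp only [Pi.pow_apply]
    rw [show k + 1 - 1 = k by omega, hc]
    set u := Real.sin (φ / 2) ^ 2
    set S := Real.sin φ
    cases m with
    | zero => simp; ring
    | succ j =>
      rw [show j + 1 - 1 = j by omega]
      push_cast
      linear_combination (((j : ℝ) + 1) * u ^ j * S ^ k / 2) * hs
  have h2 := intervalIntegral.integral_eq_sub_of_hasDerivAt h
    (Continuous.intervalIntegrable (by fun_prop) _ _)
  rw [intervalIntegral.integral_sub (Continuous.intervalIntegrable (by fun_prop) _ _)
    (Continuous.intervalIntegrable (by fun_prop) _ _), intervalIntegral.integral_const_mul,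
    intervalIntegral.integral_const_mul] at h2
  simp only [Real.sin_pi, Real.sin_zero, ne_eq, show n ≠ 0 by omega, not_false_eq_true, zero_pow,
    mul_zero, sub_zero] at h2
  unfold sinMoment
  linarith

theorem poch_succ (x : ℝ) (k : ℕ) : poch x (k + 1) = poch x k * (x + k) :=
  Finset.prod_range_succ _ _

theorem poch_pos {x : ℝ} (hx : 0 < x) (k : ℕ) : 0 < poch x k :=
  Finset.prod_pos fun i _ => by positivity

theorem poch_mul_sinMoment {n : ℕ} (hn : 2 ≤ n) (k : ℕ) :
    poch n k / poch ((n : ℝ) / 2 + 1) k * sinMoment n (k + 1) π =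
      ((n : ℝ) / 2) / (n + k) * sinMoment n 0 π := by
  have hn' : (0 : ℝ) < n := by exact_mod_cast (by omega : 0 < n)
  induction k with
  | zero =>
    have := sinMoment_pi_succ hn 0
    simp only [Nat.cast_zero, add_zero, zero_add] at this
    simp only [poch, Finset.range_zero, Finset.prod_empty, Nat.cast_zero, add_zero, zero_add]
    field_simp
    field_simp at this
    linarith
  | succ k ih =>
    have h := sinMoment_pi_succ hn (k + 1)
    have hp : 0 < poch ((n : ℝ) / 2 + 1) k := poch_pos (by positivity) k
    have hx : sinMoment n (k + 1 + 1) π =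
        ((n : ℝ) / 2 + (k + 1)) / (n + (k + 1)) * sinMoment n (k + 1) π := by
      field_simp
      push_cast at h
      linarith
    have e : poch n (k + 1) / poch ((n : ℝ) / 2 + 1) (k + 1) *
        (((n : ℝ) / 2 + (k + 1)) / (n + (k + 1)) * sinMoment n (k + 1) π) =
        (poch n k / poch ((n : ℝ) / 2 + 1) k * sinMoment n (k + 1) π) *
          ((n + k) / (n + (k + 1))) := by
      rw [poch_succ, poch_succ, show (n : ℝ) / 2 + 1 + k = n / 2 + (k + 1) by ring]
      field_simp
    rw [hx, e, ih]
    push_cast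
    field_simp

theorem hasDerivAt_tsum_of_deriv_pow {g : ℕ → ℝ → ℝ} {d : ℕ → ℝ}
    (hg : ∀ k y, HasDerivAt (g k) (d k * y ^ k) y)
    (hd : ∀ r : ℝ, 0 < r → r < 1 → Summable fun k => |d k| * r ^ k)
    (h0 : Summable fun k => g k 0) {x : ℝ} (hx : |x| < 1) :
    HasDerivAt (fun y => ∑' k, g k y) (∑' k, d k * x ^ k) x := by
  obtain ⟨r, hr, hr1⟩ := exists_between hx
  have hr0 : 0 < r := (abs_nonneg x).trans_lt hr
  refine hasDerivAt_tsum_of_isPreconnected (t := Metric.ball 0 r) (y₀ := 0) (hd r hr0 hr1)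
    Metric.isOpen_ball (convex_ball _ _).isPreconnected (fun k y _ => hg k y) (fun k y hy => ?_)
    (Metric.mem_ball_self hr0) h0 (by simpa using hr)
  rw [norm_mul, norm_pow]
  gcongr
  · exact le_rfl
  · simpa using (Metric.mem_ball.1 hy).le

theorem summable_succ_mul_pow {d : ℕ → ℝ}
    (hd : ∀ r : ℝ, 0 < r → r < 1 → Summable fun k => |d k| * r ^ k) {r : ℝ} (hr : 0 < r)
    (hr1 : r < 1) : Summable fun k : ℕ => |((k : ℝ) + 1) * d (k + 1)| * r ^ k := by
  obtain ⟨R, hrR, hR1⟩ := exists_between hr1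
  have hR0 : 0 < R := hr.trans hrR
  have hq : |r / R| < 1 := by
    rw [abs_of_pos (by positivity)]; exact (div_lt_one hR0).2 hrR
  have h1 := tendsto_self_mul_const_pow_of_abs_lt_one hq
  obtain ⟨M, hM⟩ := (h1.comp (tendsto_add_atTop_nat 1)).bddAbove_range
  have h2 := ((summable_nat_add_iff 1).2 (hd R hR0 hR1)).mul_left (M / r)
  refine Summable.of_nonneg_of_le (fun k => by positivity) (fun k => ?_) h2
  have h3 : ((k + 1 : ℕ) : ℝ) * (r / R) ^ (k + 1) ≤ M := hM ⟨k, rfl⟩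
  have h4 : ((k : ℝ) + 1) * r ^ k ≤ M / r * R ^ (k + 1) := by
    rw [div_pow, mul_div_assoc', div_le_iff₀ (by positivity)] at h3
    rw [div_mul_eq_mul_div, le_div_iff₀ hr]
    push_cast at h3
    calc _ = ((k : ℝ) + 1) * r ^ (k + 1) := by ring
      _ ≤ _ := h3
  rw [abs_mul, abs_of_nonneg (by positivity : (0 : ℝ) ≤ (k : ℝ) + 1)]
  calc _ = |d (k + 1)| * (((k : ℝ) + 1) * r ^ k) := by ring
    _ ≤ |d (k + 1)| * (M / r * R ^ (k + 1)) := by gcongr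
    _ = _ := by ring

theorem summable_mul_pow {d : ℕ → ℝ}
    (hd : ∀ r : ℝ, 0 < r → r < 1 → Summable fun k => |d k| * r ^ k) {x : ℝ} (hx : |x| < 1) :
    Summable fun k => d k * x ^ k := by
  obtain ⟨r, hr, hr1⟩ := exists_between hx
  refine Summable.of_norm_bounded (hd r ((abs_nonneg x).trans_lt hr) hr1) fun k => ?_
  rw [norm_mul, norm_pow]
  gcongr
  · exact le_rfl
  · exact hr.le

theorem hasDerivAt_tsum_mul_pow {d : ℕ → ℝ}
    (hd : ∀ r : ℝ, 0 < r → r < 1 → Summable fun k => |d k| * r ^ k) {x : ℝ} (hx : |x| < 1) :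
    HasDerivAt (fun y => ∑' k, d k * y ^ k) (∑' k : ℕ, (((k : ℝ) + 1) * d (k + 1)) * x ^ k) x := by
  have h := (hasDerivAt_tsum_of_deriv_pow (g := fun k y => d (k + 1) * y ^ (k + 1))
    (fun k y => ((hasDerivAt_pow (k + 1) y).const_mul (d (k + 1))).congr_deriv
      (by rw [Nat.add_sub_cancel]; push_cast; ring))
    (fun r => summable_succ_mul_pow hd) (by simp [summable_zero]) hx).const_add (d 0)
  refine h.congr_of_eventuallyEq ?_
  filter_upwards [(continuous_abs.tendsto x).eventually (gt_mem_nhds hx)] with y hy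
  rw [(summable_mul_pow hd hy).tsum_eq_zero_add]
  simp

/-- The Taylor coefficients of the derivative of the Green function, up to normalization. -/
noncomputable def greenCoeff (n k : ℕ) : ℝ := poch n k / poch ((n : ℝ) / 2 + 1) k

/-- The mean value of the `k + 1`-st power of `(1 + ⟪p, q⟫) / 2` over the sphere. -/
noncomputable def greenMean (n k : ℕ) : ℝ := sinMoment n (k + 1) π / sinMoment n 0 π

/-- The Green function in the variable `(1 + ⟪p, q⟫) / 2`, up to normalization. -/
noncomputable def greenSeries (n : ℕ) (x : ℝ) : ℝ :=
  ∑' k : ℕ, greenCoeff n k / (k + 1) * (x ^ (k + 1) - greenMean n k)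

theorem greenCoeff_pos {n : ℕ} (hn : 2 ≤ n) (k : ℕ) : 0 < greenCoeff n k := by
  have hn' : (0 : ℝ) < n := by exact_mod_cast (by omega : 0 < n)
  exact div_pos (poch_pos hn' k) (poch_pos (by positivity) k)

theorem greenCoeff_succ {n : ℕ} (k : ℕ) :
    ((n : ℝ) / 2 + k + 1) * greenCoeff n (k + 1) = (n + k) * greenCoeff n k := by
  have h : 0 < poch ((n : ℝ) / 2 + 1) k := poch_pos (by positivity) k
  rw [greenCoeff, greenCoeff, poch_succ, poch_succ,
    show (n : ℝ) / 2 + 1 + k = n / 2 + k + 1 by ring]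
  field_simp

theorem summable_greenCoeff {n : ℕ} (hn : 2 ≤ n) {r : ℝ} (hr : 0 < r) (hr1 : r < 1) :
    Summable fun k => |greenCoeff n k| * r ^ k := by
  have hp := greenCoeff_pos hn
  refine summable_of_ratio_test_tendsto_lt_one hr1
    (Eventually.of_forall fun k => by have := hp k; positivity) ?_
  have h := (tendsto_add_mul_div_add_mul_atTop_nhds (n : ℝ) ((n : ℝ) / 2 + 1) (1 : ℝ)
    (one_ne_zero (α := ℝ))).mul_const r
  simp only [div_one, one_mul] at h
  refine h.congr fun k => ?_
  have h1 := hp k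
  have h2 := hp (k + 1)
  have h3 := greenCoeff_succ (n := n) k
  rw [Real.norm_of_nonneg (by positivity), Real.norm_of_nonneg (by positivity), abs_of_pos h1,
    abs_of_pos h2, pow_succ, div_mul_eq_mul_div, div_eq_div_iff (by positivity) (by positivity)]
  linear_combination (-(r * r ^ k)) * h3

theorem greenCoeff_mul_greenMean {n : ℕ} (hn : 2 ≤ n) (k : ℕ) :
    greenCoeff n k / (k + 1) * greenMean n k = ((n : ℝ) / 2) / (n + k) / (k + 1) := by
  have h := poch_mul_sinMoment hn k
  have h0 := sinMoment_pos n 0 Real.pi_pos le_rfl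
  rw [greenMean, div_mul_div_comm, mul_comm ((k : ℝ) + 1), ← div_div, greenCoeff, h]
  field_simp

theorem summable_greenCoeff_mul_greenMean {n : ℕ} (hn : 2 ≤ n) :
    Summable fun k : ℕ => greenCoeff n k / (k + 1) * greenMean n k := by
  have hn' : (2 : ℝ) ≤ n := by exact_mod_cast hn
  have h := (((summable_nat_add_iff 1).2
    (Real.summable_one_div_nat_pow.2 (by norm_num : 1 < 2))).mul_left ((n : ℝ) / 2))
  refine Summable.of_nonneg_of_le (fun k => ?_) (fun k => ?_) h
  · rw [greenCoeff_mul_greenMean hn]; positivity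
  · rw [greenCoeff_mul_greenMean hn, div_div, mul_one_div]
    push_cast
    gcongr
    nlinarith [(Nat.cast_nonneg k : (0 : ℝ) ≤ k)]

theorem hasDerivAt_greenSeries {n : ℕ} (hn : 2 ≤ n) {x : ℝ} (hx : |x| < 1) :
    HasDerivAt (greenSeries n) (∑' k, greenCoeff n k * x ^ k) x := by
  refine hasDerivAt_tsum_of_deriv_pow (fun k y => ?_) (fun r => summable_greenCoeff hn) ?_ hx
  · refine (((hasDerivAt_pow (k + 1) y).sub_const (greenMean n k)).const_mul
      (greenCoeff n k / (k + 1))).congr_deriv ?_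
    rw [Nat.add_sub_cancel]
    push_cast
    field_simp
  · simpa using (summable_greenCoeff_mul_greenMean hn).neg

theorem greenSeries_ode {n : ℕ} (hn : 2 ≤ n) {x : ℝ} (hx : |x| < 1) :
    x * (1 - x) * (∑' k : ℕ, (((k : ℝ) + 1) * greenCoeff n (k + 1)) * x ^ k) +
      n / 2 * (1 - 2 * x) * (∑' k, greenCoeff n k * x ^ k) = n / 2 := by
  have hd := fun r => summable_greenCoeff hn (r := r)
  have s1 := summable_mul_pow hd hx
  have s2 := summable_mul_pow (fun r => summable_succ_mul_pow hd) hx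
  set A := ∑' k, greenCoeff n k * x ^ k with hA
  set B := ∑' k : ℕ, (((k : ℝ) + 1) * greenCoeff n (k + 1)) * x ^ k with hB
  have h0 : greenCoeff n 0 = 1 := by simp [greenCoeff, poch]
  have t1 : HasSum (fun k => greenCoeff n (k + 1) * x ^ (k + 1)) (A - 1) := by
    rw [hasSum_nat_add_iff (f := fun k => greenCoeff n k * x ^ k) 1]
    simpa [h0] using s1.hasSum
  have t2 : HasSum (fun k : ℕ => (k + 1) * greenCoeff n (k + 1) * x ^ (k + 1)) (x * B) := by
    have h := s2.hasSum.mul_left x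
    have e : ∀ k : ℕ, x * (((k : ℝ) + 1) * greenCoeff n (k + 1) * x ^ k) =
        (k + 1) * greenCoeff n (k + 1) * x ^ (k + 1) := fun k => by ring
    simpa only [e] using h
  have t3 : HasSum (fun k : ℕ => (k : ℝ) * greenCoeff n k * x ^ k) (x * B) := by
    rw [← hasSum_nat_add_iff' 1]
    simpa using t2
  have e1 := (t2.add (t1.mul_left ((n : ℝ) / 2)))
  have e2 := (t3.add (s1.hasSum.mul_left (n : ℝ))).mul_left x
  have e : ∀ k : ℕ, x * ((k : ℝ) * greenCoeff n k * x ^ k + n * (greenCoeff n k * x ^ k)) =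
      ((k : ℝ) + 1) * greenCoeff n (k + 1) * x ^ (k + 1) +
        (n : ℝ) / 2 * (greenCoeff n (k + 1) * x ^ (k + 1)) := fun k => by
    linear_combination -x ^ (k + 1) * greenCoeff_succ (n := n) k
  simp only [e] at e2
  linear_combination e1.unique e2

theorem hasDerivAt_setIntegral_of_isCompact {X : Type*} [TopologicalSpace X] [MeasurableSpace X]
    [OpensMeasurableSpace X] {μ : Measure X} [IsFiniteMeasure μ] {K : Set X} (hK : IsCompact K)
    (hKm : MeasurableSet K) {U : Set ℝ} (hU : IsOpen U) {F F' : ℝ → X → ℝ}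
    (hF : ∀ t ∈ U, ContinuousOn (F t) K)
    (hF' : ContinuousOn (Function.uncurry F') (U ×ˢ K))
    (hd : ∀ t ∈ U, ∀ q ∈ K, HasDerivAt (fun t => F t q) (F' t q) t) {t₀ : ℝ} (ht : t₀ ∈ U) :
    IntegrableOn (F' t₀) K μ ∧
      HasDerivAt (fun t => ∫ q in K, F t q ∂μ) (∫ q in K, F' t₀ q ∂μ) t₀ := by
  obtain ⟨ε, hε, hεU⟩ := Metric.nhds_basis_closedBall.mem_iff.1 (hU.mem_nhds ht)
  obtain ⟨C, hC⟩ := ((isCompact_closedBall t₀ ε).prod hK).exists_bound_of_continuousOn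
    (hF'.mono (Set.prod_mono hεU le_rfl))
  have hF'c : ∀ t ∈ U, ContinuousOn (F' t) K := fun t ht =>
    hF'.comp (f := fun q => (t, q)) (by fun_prop) fun q hq => ⟨ht, hq⟩
  have hμ : μ K < ⊤ := measure_lt_top _ _
  refine hasDerivAt_integral_of_dominated_loc_of_deriv_le (bound := fun _ => C)
    (Metric.closedBall_mem_nhds t₀ hε) ?_ ?_ ((hF'c _ ht).aestronglyMeasurable hKm) ?_ ?_ ?_
  · filter_upwards [hU.mem_nhds ht] with t ht using (hF t ht).aestronglyMeasurable hKm
  · obtain ⟨D, hD⟩ := hK.exists_bound_of_continuousOn (hF _ ht)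
    exact IntegrableOn.of_bound hμ ((hF _ ht).aestronglyMeasurable hKm) D
      ((ae_restrict_iff' hKm).2 (Eventually.of_forall hD))
  · exact (ae_restrict_iff' hKm).2 (Eventually.of_forall fun q hq t ht => hC (t, q) ⟨ht, hq⟩)
  · exact integrable_const _
  · exact (ae_restrict_iff' hKm).2 (Eventually.of_forall fun q hq t ht => hd t (hεU ht) q hq)

theorem eq_of_sin_mul_add_cos_mul_eq_zero {w w₁ w₂ : ℝ → ℝ} {N : ℕ} (hN : N ≠ 0) {b : ℝ}
    (hb : 0 ≤ b) (hbπ : b < π) (h₁ : ∀ θ ∈ Set.Icc 0 b, HasDerivAt w (w₁ θ) θ)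
    (h₂ : ∀ θ ∈ Set.Icc 0 b, HasDerivAt w₁ (w₂ θ) θ)
    (h : ∀ θ ∈ Set.Icc 0 b, Real.sin θ * w₂ θ + N * Real.cos θ * w₁ θ = 0) : w b = w 0 := by
  obtain ⟨M, rfl⟩ := Nat.exists_eq_succ_of_ne_zero hN
  have hu : ∀ θ ∈ Set.Icc 0 b, HasDerivAt (fun θ => Real.sin θ ^ (M + 1) * w₁ θ) 0 θ := by
    intro θ hθ
    refine (((Real.hasDerivAt_sin θ).pow (M + 1)).mul (h₂ θ hθ)).congr_deriv ?_
    have := h θ hθ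
    simp only [Pi.pow_apply, Nat.add_sub_cancel]
    push_cast at this ⊢
    linear_combination Real.sin θ ^ M * this
  have hu0 := constant_of_has_deriv_right_zero
    (fun θ hθ => (hu θ hθ).continuousAt.continuousWithinAt)
    (fun θ hθ => (hu θ ⟨hθ.1, hθ.2.le⟩).hasDerivWithinAt)
  have hw : ∀ θ ∈ Set.Icc 0 b, w₁ θ = 0 := by
    intro θ hθ
    rcases hθ.1.eq_or_lt with h0 | h0
    · subst h0
      have := h 0 hθ
      simp only [Real.sin_zero, Real.cos_zero, zero_mul, zero_add, mul_one] at this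
      exact (mul_eq_zero.1 this).resolve_left (by positivity)
    · have h3 := hu0 θ hθ
      simp only [Real.sin_zero, ne_eq, Nat.succ_ne_zero, not_false_eq_true, zero_pow,
        zero_mul] at h3
      have h4 := Real.sin_pos_of_pos_of_lt_pi h0 (hθ.2.trans_lt hbπ)
      exact (mul_eq_zero.1 h3).resolve_left (by positivity)
  refine constant_of_has_deriv_right_zero
    (fun θ hθ => (h₁ θ hθ).continuousAt.continuousWithinAt)
    (fun θ hθ => ?_) b ⟨hb, le_rfl⟩
  have := h₁ θ ⟨hθ.1, hθ.2.le⟩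
  rw [hw θ ⟨hθ.1, hθ.2.le⟩] at this
  exact this.hasDerivWithinAt

theorem cos_mul_add_sin_mul_mem_Ioo {a s t θ : ℝ} (ha : a ≤ π) (hθ : θ ∈ Set.Ioo (-a) a)
    (h : s ^ 2 + t ^ 2 ≤ 1) (hs : s ≤ Real.cos a) :
    Real.cos θ * s + Real.sin θ * t ∈ Set.Ioo (-3 : ℝ) 1 := by
  have h1 : Real.cos a < Real.cos θ := by
    rw [← Real.cos_abs θ]
    exact Real.cos_lt_cos_of_nonneg_of_le_pi (abs_nonneg _) ha (abs_lt.2 hθ)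
  have h2 := Real.sin_sq_add_cos_sq θ
  constructor
  · nlinarith [sq_nonneg (Real.cos θ + s), sq_nonneg (Real.sin θ + t)]
  · nlinarith [sq_nonneg (Real.sin θ - t), mul_self_pos.2 (by linarith : Real.cos θ - s ≠ 0)]

set_option maxHeartbeats 2000000 in
theorem setIntegral_rotation_eq {X ι : Type*} [Fintype ι] [Nonempty ι] [TopologicalSpace X]
    [MeasurableSpace X] [OpensMeasurableSpace X] {μ : Measure X} [IsFiniteMeasure μ] {K : Set X}
    (hK : IsCompact K) (hKm : MeasurableSet K) {x₀ x₁ : X → ℝ} {z : ι → X → ℝ}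
    (hx₀ : Continuous x₀) (hx₁ : Continuous x₁) (hz : ∀ i, Continuous (z i))
    (hs : ∀ q, x₀ q ^ 2 + x₁ q ^ 2 + ∑ i, z i q ^ 2 = 1) {a : ℝ} (ha : a ∈ Set.Ioo 0 π)
    (hKa : ∀ q ∈ K, x₀ q ≤ Real.cos a) {H H₁ H₂ : ℝ → ℝ}
    (h₁ : ∀ y ∈ Set.Ioo (-3 : ℝ) 1, HasDerivAt H (H₁ y) y)
    (h₂ : ∀ y ∈ Set.Ioo (-3 : ℝ) 1, HasDerivAt H₁ (H₂ y) y)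
    (hc : ContinuousOn H₂ (Set.Ioo (-3 : ℝ) 1)) {κ : ℝ}
    (hode : ∀ y ∈ Set.Ioo (-3 : ℝ) 1,
      (1 - y ^ 2) * H₂ y - (Fintype.card ι + 1) * y * H₁ y = κ)
    (hsym : ∀ (θ ψ : ℝ) (i : ι), ∫ q in K,
      H₁ (Real.cos θ * x₀ q + Real.sin θ * (Real.cos ψ * x₁ q + Real.sin ψ * z i q)) *
        (-Real.sin ψ * x₁ q + Real.cos ψ * z i q) ∂μ = 0)
    {θ₀ : ℝ} (hθ₀ : θ₀ ∈ Set.Ico 0 a) :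
    ∫ q in K, H (Real.cos θ₀ * x₀ q + Real.sin θ₀ * x₁ q) ∂μ =
      ∫ q in K, H (x₀ q) ∂μ + μ.real K * (H (-Real.cos θ₀) - H (-1)) := by
  set I := Set.Ioo (-3 : ℝ) 1 with hI
  set U := Set.Ioo (-a) a with hU
  have hc₀ : ContinuousOn H I := fun y hy => (h₁ y hy).continuousAt.continuousWithinAt
  have hc₁ : ContinuousOn H₁ I := fun y hy => (h₂ y hy).continuousAt.continuousWithinAt
  have hle : ∀ q, x₀ q ^ 2 + x₁ q ^ 2 ≤ 1 := fun q => by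
    have : 0 ≤ ∑ i, z i q ^ 2 := Finset.sum_nonneg fun i _ => sq_nonneg _
    linarith [hs q]
  have hlez : ∀ q i ψ, x₀ q ^ 2 + (Real.cos ψ * x₁ q + Real.sin ψ * z i q) ^ 2 ≤ 1 :=
    fun q i ψ => by
      have : z i q ^ 2 ≤ ∑ i, z i q ^ 2 :=
        Finset.single_le_sum (f := fun i => z i q ^ 2) (fun i _ => sq_nonneg _) (Finset.mem_univ i)
      have h3 := Real.sin_sq_add_cos_sq ψ
      nlinarith [hs q, sq_nonneg (Real.sin ψ * x₁ q - Real.cos ψ * z i q)]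
  have hyI : ∀ θ ∈ U, ∀ q ∈ K, Real.cos θ * x₀ q + Real.sin θ * x₁ q ∈ I := fun θ hθ q hq =>
    cos_mul_add_sin_mul_mem_Ioo ha.2.le hθ (hle q) (hKa q hq)
  have hyIz : ∀ θ ∈ U, ∀ q ∈ K, ∀ i ψ, Real.cos θ * x₀ q +
      Real.sin θ * (Real.cos ψ * x₁ q + Real.sin ψ * z i q) ∈ I := fun θ hθ q hq i ψ =>
    cos_mul_add_sin_mul_mem_Ioo ha.2.le hθ (hlez q i ψ) (hKa q hq)
  have hdy : ∀ (q : X) (θ : ℝ), HasDerivAt (fun θ => Real.cos θ * x₀ q + Real.sin θ * x₁ q)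
      (-Real.sin θ * x₀ q + Real.cos θ * x₁ q) θ := fun q θ =>
    ((Real.hasDerivAt_cos θ).mul_const _).add ((Real.hasDerivAt_sin θ).mul_const _)
  have hdy' : ∀ (q : X) (θ : ℝ), HasDerivAt (fun θ => -Real.sin θ * x₀ q + Real.cos θ * x₁ q)
      (-(Real.cos θ * x₀ q + Real.sin θ * x₁ q)) θ := fun q θ =>
    (((Real.hasDerivAt_sin θ).neg.mul_const _).add
      ((Real.hasDerivAt_cos θ).mul_const _)).congr_deriv (by ring)
  have d₁ : ∀ θ ∈ U, IntegrableOn (fun q => H₁ (Real.cos θ * x₀ q + Real.sin θ * x₁ q) *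
        (-Real.sin θ * x₀ q + Real.cos θ * x₁ q)) K μ ∧ HasDerivAt
      (fun θ => ∫ q in K, H (Real.cos θ * x₀ q + Real.sin θ * x₁ q) ∂μ)
      (∫ q in K, H₁ (Real.cos θ * x₀ q + Real.sin θ * x₁ q) *
        (-Real.sin θ * x₀ q + Real.cos θ * x₁ q) ∂μ) θ := by
    intro θ hθ
    refine hasDerivAt_setIntegral_of_isCompact (U := U)
      (F := fun θ q => H (Real.cos θ * x₀ q + Real.sin θ * x₁ q))
      (F' := fun θ q => H₁ (Real.cos θ * x₀ q + Real.sin θ * x₁ q) *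
        (-Real.sin θ * x₀ q + Real.cos θ * x₁ q)) hK hKm isOpen_Ioo
      (fun t ht => hc₀.comp (by fun_prop) (hyI t ht)) ?_
      (fun t ht q hq => (h₁ _ (hyI t ht q hq)).comp t (hdy q t)) hθ
    exact (hc₁.comp (f := fun s : ℝ × X => Real.cos s.1 * x₀ s.2 + Real.sin s.1 * x₁ s.2)
      (by fun_prop) fun s hs => hyI s.1 hs.1 s.2 hs.2).mul (by fun_prop)
  have d₂ : ∀ θ ∈ U, IntegrableOn (fun q => H₂ (Real.cos θ * x₀ q + Real.sin θ * x₁ q) *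
        (-Real.sin θ * x₀ q + Real.cos θ * x₁ q) ^ 2 -
        H₁ (Real.cos θ * x₀ q + Real.sin θ * x₁ q) *
          (Real.cos θ * x₀ q + Real.sin θ * x₁ q)) K μ ∧ HasDerivAt
      (fun θ => ∫ q in K, H₁ (Real.cos θ * x₀ q + Real.sin θ * x₁ q) *
        (-Real.sin θ * x₀ q + Real.cos θ * x₁ q) ∂μ)
      (∫ q in K, (H₂ (Real.cos θ * x₀ q + Real.sin θ * x₁ q) *
        (-Real.sin θ * x₀ q + Real.cos θ * x₁ q) ^ 2 -
        H₁ (Real.cos θ * x₀ q + Real.sin θ * x₁ q) *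
          (Real.cos θ * x₀ q + Real.sin θ * x₁ q)) ∂μ) θ := by
    intro θ hθ
    refine hasDerivAt_setIntegral_of_isCompact (U := U)
      (F := fun θ q => H₁ (Real.cos θ * x₀ q + Real.sin θ * x₁ q) *
        (-Real.sin θ * x₀ q + Real.cos θ * x₁ q))
      (F' := fun θ q => H₂ (Real.cos θ * x₀ q + Real.sin θ * x₁ q) *
        (-Real.sin θ * x₀ q + Real.cos θ * x₁ q) ^ 2 -
        H₁ (Real.cos θ * x₀ q + Real.sin θ * x₁ q) *
          (Real.cos θ * x₀ q + Real.sin θ * x₁ q)) hK hKm isOpen_Ioo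
      (fun t ht => (hc₁.comp (by fun_prop) (hyI t ht)).mul (by fun_prop)) ?_
      (fun t ht q hq => (((h₂ _ (hyI t ht q hq)).comp t (hdy q t)).mul (hdy' q t)).congr_deriv
        (by simp only [Function.comp]; ring)) hθ
    exact ((hc.comp (f := fun s : ℝ × X => Real.cos s.1 * x₀ s.2 + Real.sin s.1 * x₁ s.2)
      (by fun_prop) fun s hs => hyI s.1 hs.1 s.2 hs.2).mul (by fun_prop)).sub
      ((hc₁.comp (f := fun s : ℝ × X => Real.cos s.1 * x₀ s.2 + Real.sin s.1 * x₁ s.2)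
      (by fun_prop) fun s hs => hyI s.1 hs.1 s.2 hs.2).mul (by fun_prop))
  have dz : ∀ θ ∈ U, ∀ i, IntegrableOn (fun q =>
        H₂ (Real.cos θ * x₀ q + Real.sin θ * x₁ q) * (Real.sin θ * z i q ^ 2) -
        H₁ (Real.cos θ * x₀ q + Real.sin θ * x₁ q) * x₁ q) K μ ∧
      ∫ q in K, (H₂ (Real.cos θ * x₀ q + Real.sin θ * x₁ q) * (Real.sin θ * z i q ^ 2) -
        H₁ (Real.cos θ * x₀ q + Real.sin θ * x₁ q) * x₁ q) ∂μ = 0 := by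
    intro θ hθ i
    have hdw : ∀ (q : X) (ψ : ℝ), HasDerivAt (fun ψ => Real.cos ψ * x₁ q + Real.sin ψ * z i q)
        (-Real.sin ψ * x₁ q + Real.cos ψ * z i q) ψ := fun q ψ =>
      ((Real.hasDerivAt_cos ψ).mul_const _).add ((Real.hasDerivAt_sin ψ).mul_const _)
    have hdw' : ∀ (q : X) (ψ : ℝ), HasDerivAt (fun ψ => -Real.sin ψ * x₁ q + Real.cos ψ * z i q)
        (-(Real.cos ψ * x₁ q + Real.sin ψ * z i q)) ψ := fun q ψ =>
      (((Real.hasDerivAt_sin ψ).neg.mul_const _).add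
        ((Real.hasDerivAt_cos ψ).mul_const _)).congr_deriv (by ring)
    have hz' := hz i
    have hm := hyIz θ hθ
    obtain ⟨hi, hd⟩ := hasDerivAt_setIntegral_of_isCompact (U := Set.univ) (μ := μ) (t₀ := 0)
      (F := fun ψ q =>
        H₁ (Real.cos θ * x₀ q + Real.sin θ * (Real.cos ψ * x₁ q + Real.sin ψ * z i q)) *
        (-Real.sin ψ * x₁ q + Real.cos ψ * z i q))
      (F' := fun ψ q =>
        H₂ (Real.cos θ * x₀ q + Real.sin θ * (Real.cos ψ * x₁ q + Real.sin ψ * z i q)) *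
        (Real.sin θ * (-Real.sin ψ * x₁ q + Real.cos ψ * z i q) ^ 2) -
        H₁ (Real.cos θ * x₀ q + Real.sin θ * (Real.cos ψ * x₁ q + Real.sin ψ * z i q)) *
        (Real.cos ψ * x₁ q + Real.sin ψ * z i q)) hK hKm isOpen_univ
      (fun t _ => (hc₁.comp (by fun_prop) fun q hq => hm q hq i t).mul (by fun_prop))
      (((hc.comp (f := fun s : ℝ × X => Real.cos θ * x₀ s.2 +
          Real.sin θ * (Real.cos s.1 * x₁ s.2 + Real.sin s.1 * z i s.2))
        (by fun_prop) fun s hs => hm s.2 hs.2 i s.1).mul (by fun_prop)).sub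
        ((hc₁.comp (f := fun s : ℝ × X => Real.cos θ * x₀ s.2 +
          Real.sin θ * (Real.cos s.1 * x₁ s.2 + Real.sin s.1 * z i s.2))
        (by fun_prop) fun s hs => hm s.2 hs.2 i s.1).mul (by fun_prop)))
      (fun t _ q hq => (((h₂ _ (hm q hq i t)).comp t
        (((hdw q t).const_mul (Real.sin θ)).const_add (Real.cos θ * x₀ q))).mul
          (hdw' q t)).congr_deriv (by simp only [Function.comp]; ring)) (Set.mem_univ _)
    simp only [hsym] at hd
    have h0 := hd.unique (hasDerivAt_const (0 : ℝ) (0 : ℝ))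
    simp only [Real.sin_zero, Real.cos_zero, one_mul, zero_mul, add_zero, neg_zero, zero_add]
      at h0 hi
    exact ⟨hi, h0⟩
  have hv : ∀ θ ∈ U, Real.sin θ * (∫ q in K, (H₂ (Real.cos θ * x₀ q + Real.sin θ * x₁ q) *
        (-Real.sin θ * x₀ q + Real.cos θ * x₁ q) ^ 2 -
        H₁ (Real.cos θ * x₀ q + Real.sin θ * x₁ q) *
          (Real.cos θ * x₀ q + Real.sin θ * x₁ q)) ∂μ) +
      Fintype.card ι * Real.cos θ * (∫ q in K, H₁ (Real.cos θ * x₀ q + Real.sin θ * x₁ q) *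
        (-Real.sin θ * x₀ q + Real.cos θ * x₁ q) ∂μ) = Real.sin θ * (μ.real K * κ) := by
    intro θ hθ
    have e : ∑ i, ∫ q in K, (H₂ (Real.cos θ * x₀ q + Real.sin θ * x₁ q) *
        (Real.sin θ * z i q ^ 2) -
        H₁ (Real.cos θ * x₀ q + Real.sin θ * x₁ q) * x₁ q) ∂μ = 0 :=
      Finset.sum_eq_zero fun i _ => (dz θ hθ i).2
    rw [← integral_finsetSum _ fun i _ => (dz θ hθ i).1] at e
    have hi : IntegrableOn (fun q => ∑ i, (H₂ (Real.cos θ * x₀ q + Real.sin θ * x₁ q) *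
        (Real.sin θ * z i q ^ 2) -
        H₁ (Real.cos θ * x₀ q + Real.sin θ * x₁ q) * x₁ q)) K μ :=
      integrable_finsetSum _ fun i _ => (dz θ hθ i).1
    have hi' : IntegrableOn (fun q => Real.sin θ *
        (H₂ (Real.cos θ * x₀ q + Real.sin θ * x₁ q) *
          (-Real.sin θ * x₀ q + Real.cos θ * x₁ q) ^ 2 -
        H₁ (Real.cos θ * x₀ q + Real.sin θ * x₁ q) *
          (Real.cos θ * x₀ q + Real.sin θ * x₁ q)) + Fintype.card ι * Real.cos θ *
        (H₁ (Real.cos θ * x₀ q + Real.sin θ * x₁ q) *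
        (-Real.sin θ * x₀ q + Real.cos θ * x₁ q))) K μ :=
      ((d₂ θ hθ).1.const_mul _).add ((d₁ θ hθ).1.const_mul _)
    rw [← add_zero (_ + _), ← e, ← integral_const_mul, ← integral_const_mul,
      ← integral_add ((d₂ θ hθ).1.const_mul _) ((d₁ θ hθ).1.const_mul _),
      ← integral_add hi' hi,
      ← smul_eq_mul (μ.real K), ← setIntegral_const, ← integral_const_mul]
    refine setIntegral_congr_fun hKm fun q hq => ?_
    have h3 := hode _ (hyI θ hθ q hq)
    have h4 : ∑ i, z i q ^ 2 = 1 - x₀ q ^ 2 - x₁ q ^ 2 := by linarith [hs q]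
    have h5 := Real.sin_sq_add_cos_sq θ
    simp only [Finset.sum_sub_distrib, ← Finset.mul_sum, h4, Finset.sum_const, nsmul_eq_mul,
      Finset.card_univ]
    rw [← h3]
    generalize H₁ (Real.cos θ * x₀ q + Real.sin θ * x₁ q) = A at *
    generalize H₂ (Real.cos θ * x₀ q + Real.sin θ * x₁ q) = B at *
    generalize (Fintype.card ι : ℝ) = N at *
    linear_combination (N * A * x₁ q + B * Real.sin θ * (x₀ q ^ 2 + x₁ q ^ 2)) * h5
  have hcos : ∀ θ ∈ Set.Icc 0 θ₀, -Real.cos θ ∈ I := fun θ hθ => by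
    have := Real.cos_lt_cos_of_nonneg_of_le_pi hθ.1 le_rfl ((hθ.2.trans_lt hθ₀.2).trans ha.2)
    rw [Real.cos_pi] at this
    exact ⟨by linarith [Real.cos_le_one θ], by linarith⟩
  have hsub : ∀ θ ∈ Set.Icc 0 θ₀, θ ∈ U := fun θ hθ =>
    ⟨by linarith [hθ.1, ha.1], hθ.2.trans_lt hθ₀.2⟩
  have hdc : ∀ θ : ℝ, HasDerivAt (fun θ => -Real.cos θ) (Real.sin θ) θ := fun θ =>
    (Real.hasDerivAt_cos θ).neg.congr_deriv (neg_neg _)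
  have key := eq_of_sin_mul_add_cos_mul_eq_zero (N := Fintype.card ι) Fintype.card_ne_zero
    hθ₀.1 (hθ₀.2.trans ha.2)
    (fun θ hθ => (d₁ θ (hsub θ hθ)).2.sub
      (((h₁ _ (hcos θ hθ)).comp θ (hdc θ)).const_mul (μ.real K)))
    (fun θ hθ => (d₂ θ (hsub θ hθ)).2.sub
      ((((h₂ _ (hcos θ hθ)).comp θ (hdc θ)).mul (Real.hasDerivAt_sin θ)).const_mul (μ.real K)))
    (fun θ hθ => by
      have h3 := hv θ (hsub θ hθ)
      have h4 := hode _ (hcos θ hθ)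
      have h5 := Real.sin_sq_add_cos_sq θ
      simp only [Function.comp] at *
      generalize H₁ (-Real.cos θ) = A at *
      generalize H₂ (-Real.cos θ) = B at *
      linear_combination h3 - Real.sin θ * μ.real K * h4 - Real.sin θ * μ.real K * B * h5)
  simp only [Pi.sub_apply, Function.comp, Real.cos_zero, Real.sin_zero, one_mul, zero_mul,
    add_zero] at key
  linear_combination key

theorem LinearIsometryEquiv.measurePreserving_sphere {n : ℕ}
    (L : EuclideanSpace ℝ (Fin (n + 1)) ≃ₗᵢ[ℝ] EuclideanSpace ℝ (Fin (n + 1)))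
    (f : Metric.sphere (0 : EuclideanSpace ℝ (Fin (n + 1))) 1 →
      Metric.sphere (0 : EuclideanSpace ℝ (Fin (n + 1))) 1)
    (hf : ∀ q, (f q : EuclideanSpace ℝ (Fin (n + 1))) = L q) :
    MeasurePreserving f (sphereMeasure n) (sphereMeasure n) := by
  have hfc : Continuous f := by
    exact continuous_induced_rng.2 ((L.continuous.comp continuous_subtype_val).congr fun q => (hf q).symm)
  refine ⟨hfc.measurable, Measure.ext fun s hs => ?_⟩
  rw [Measure.map_apply hfc.measurable hs, sphereMeasure,
    Measure.toSphere_apply' _ (hfc.measurable hs), Measure.toSphere_apply' _ hs]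
  congr 1
  refine (congrArg _ ?_).trans
    (L.measurePreserving.measure_preimage_equiv (f := L.toMeasurableEquiv) _)
  ext x
  simp only [Set.mem_preimage, Set.mem_smul, Set.mem_image, LinearIsometryEquiv.coe_toMeasurableEquiv]
  constructor
  · rintro ⟨r, hr, y, ⟨q, hq, rfl⟩, rfl⟩
    exact ⟨r, hr, _, ⟨f q, hq, rfl⟩, by rw [hf, map_smul]⟩
  · rintro ⟨r, hr, y, ⟨q, hq, rfl⟩, h⟩
    let q' : Metric.sphere (0 : EuclideanSpace ℝ (Fin (n + 1))) 1 := ⟨L.symm q, by simp⟩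
    have hq' : f q' = q := Subtype.ext (by rw [hf]; simp [q'])
    refine ⟨r, hr, _, ⟨q', by rwa [hq'], rfl⟩, L.injective ?_⟩
    rw [← h, map_smul]
    simp [q']

theorem setIntegral_mul_inner_eq_zero {n : ℕ} {p u f : EuclideanSpace ℝ (Fin (n + 1))}
    (hp : ⟪f, p⟫ = 0) (hu : ⟪f, u⟫ = 0) (c : ℝ) (h : ℝ → ℝ) :
    ∫ q in {q : Metric.sphere (0 : EuclideanSpace ℝ (Fin (n + 1))) 1 |
        ⟪p, (q : EuclideanSpace ℝ (Fin (n + 1)))⟫ ≤ c},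
      h ⟪u, (q : EuclideanSpace ℝ (Fin (n + 1)))⟫ * ⟪f, (q : EuclideanSpace ℝ (Fin (n + 1)))⟫
        ∂(sphereMeasure n) = 0 := by
  set R := (ℝ ∙ f)ᗮ.reflection with hR
  let r : Metric.sphere (0 : EuclideanSpace ℝ (Fin (n + 1))) 1 →
      Metric.sphere (0 : EuclideanSpace ℝ (Fin (n + 1))) 1 := fun q => ⟨R q, by simp⟩
  have hr := R.measurePreserving_sphere r fun q => rfl
  have hrr : ∀ q, r (r q) = q := fun q => Subtype.ext (by simp [r, R])
  have hre : MeasurableEmbedding r :=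
    (MeasurableEquiv.mk ⟨r, r, hrr, hrr⟩ hr.measurable hr.measurable).measurableEmbedding
  have hR' : ∀ x y, ⟪x, R y⟫ = ⟪R x, y⟫ := fun x y => by
    rw [← R.inner_map_map x, hR, Submodule.reflection_reflection]
  have hRp : R p = p := Submodule.reflection_mem_subspace_eq_self
    (Submodule.mem_orthogonal_singleton_iff_inner_right.2 hp)
  have hRu : R u = u := Submodule.reflection_mem_subspace_eq_self
    (Submodule.mem_orthogonal_singleton_iff_inner_right.2 hu)
  have hRf : R f = -f := Submodule.reflection_orthogonalComplement_singleton_eq_neg f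
  have key := hr.setIntegral_preimage_emb hre
    (fun q : Metric.sphere (0 : EuclideanSpace ℝ (Fin (n + 1))) 1 =>
      h ⟪u, (q : EuclideanSpace ℝ (Fin (n + 1)))⟫ * ⟪f, (q : EuclideanSpace ℝ (Fin (n + 1)))⟫)
    {q | ⟪p, (q : EuclideanSpace ℝ (Fin (n + 1)))⟫ ≤ c}
  simp only [Set.preimage_ofPred_eq, r, hR', hRp, hRu, hRf, inner_neg_left, mul_neg,
    integral_neg] at key
  linarith

theorem setIntegral_compl_cap_eq {n : ℕ} (hn : 2 ≤ n)
    {p₀ p : Metric.sphere (0 : EuclideanSpace ℝ (Fin (n + 1))) 1} (hne : p ≠ p₀)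
    {a : ℝ} (ha : a ∈ Set.Ioo 0 π)
    (hp : Real.arccos ⟪(p₀ : EuclideanSpace ℝ (Fin (n + 1))),
      (p : EuclideanSpace ℝ (Fin (n + 1)))⟫ < a) {H H₁ H₂ : ℝ → ℝ}
    (h₁ : ∀ y ∈ Set.Ioo (-3 : ℝ) 1, HasDerivAt H (H₁ y) y)
    (h₂ : ∀ y ∈ Set.Ioo (-3 : ℝ) 1, HasDerivAt H₁ (H₂ y) y)
    (hc : ContinuousOn H₂ (Set.Ioo (-3 : ℝ) 1)) {κ : ℝ}
    (hode : ∀ y ∈ Set.Ioo (-3 : ℝ) 1, (1 - y ^ 2) * H₂ y - n * y * H₁ y = κ) :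
    ∫ q in {q : Metric.sphere (0 : EuclideanSpace ℝ (Fin (n + 1))) 1 |
        ⟪(p₀ : EuclideanSpace ℝ (Fin (n + 1))), (q : EuclideanSpace ℝ (Fin (n + 1)))⟫ ≤
          Real.cos a},
      H ⟪(p : EuclideanSpace ℝ (Fin (n + 1))), (q : EuclideanSpace ℝ (Fin (n + 1)))⟫
        ∂(sphereMeasure n) =
    ∫ q in {q : Metric.sphere (0 : EuclideanSpace ℝ (Fin (n + 1))) 1 |
        ⟪(p₀ : EuclideanSpace ℝ (Fin (n + 1))), (q : EuclideanSpace ℝ (Fin (n + 1)))⟫ ≤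
          Real.cos a},
      H ⟪(p₀ : EuclideanSpace ℝ (Fin (n + 1))), (q : EuclideanSpace ℝ (Fin (n + 1)))⟫
        ∂(sphereMeasure n) +
    (sphereMeasure n).real {q : Metric.sphere (0 : EuclideanSpace ℝ (Fin (n + 1))) 1 |
        ⟪(p₀ : EuclideanSpace ℝ (Fin (n + 1))), (q : EuclideanSpace ℝ (Fin (n + 1)))⟫ ≤
          Real.cos a} *
      (H (-⟪(p₀ : EuclideanSpace ℝ (Fin (n + 1))), (p : EuclideanSpace ℝ (Fin (n + 1)))⟫)
        - H (-1)) := by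
  have : IsFiniteMeasure (sphereMeasure n) := by unfold sphereMeasure; infer_instance
  have n₀ : ‖(p₀ : EuclideanSpace ℝ (Fin (n + 1)))‖ = 1 := by simp
  have n₁ : ‖(p : EuclideanSpace ℝ (Fin (n + 1)))‖ = 1 := by simp
  have i₀ : ⟪(p₀ : EuclideanSpace ℝ (Fin (n + 1))), (p₀ : EuclideanSpace ℝ (Fin (n + 1)))⟫ = 1 := by
    rw [real_inner_self_eq_norm_sq, n₀, one_pow]
  have i₁ : ⟪(p : EuclideanSpace ℝ (Fin (n + 1))), (p : EuclideanSpace ℝ (Fin (n + 1)))⟫ = 1 := by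
    rw [real_inner_self_eq_norm_sq, n₁, one_pow]
  set θ := Real.arccos ⟪(p₀ : EuclideanSpace ℝ (Fin (n + 1))),
    (p : EuclideanSpace ℝ (Fin (n + 1)))⟫ with hθ
  have hcos : Real.cos θ = ⟪(p₀ : EuclideanSpace ℝ (Fin (n + 1))),
      (p : EuclideanSpace ℝ (Fin (n + 1)))⟫ := by
    have := abs_le.1 (abs_real_inner_le_norm (p₀ : EuclideanSpace ℝ (Fin (n + 1)))
      (p : EuclideanSpace ℝ (Fin (n + 1))))
    rw [n₀, n₁, one_mul] at this
    exact Real.cos_arccos this.1 this.2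
  have hθ0 : 0 < θ := by
    rw [hθ, Real.arccos_pos]
    exact (inner_lt_one_iff_real_of_norm_eq_one n₀ n₁).2 fun h => hne (Subtype.ext h.symm)
  have hsin : 0 < Real.sin θ := Real.sin_pos_of_pos_of_lt_pi hθ0 (hp.trans ha.2)
  obtain ⟨e, he⟩ : ∃ e : EuclideanSpace ℝ (Fin (n + 1)),
      Real.cos θ • (p₀ : EuclideanSpace ℝ (Fin (n + 1))) + Real.sin θ • e = p :=
    ⟨(Real.sin θ)⁻¹ • ((p : EuclideanSpace ℝ (Fin (n + 1))) - Real.cos θ • p₀), by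
      rw [smul_inv_smul₀ hsin.ne']; abel⟩
  have ie₀ : ⟪(p₀ : EuclideanSpace ℝ (Fin (n + 1))), e⟫ = 0 := by
    have h := hcos
    rw [← he, inner_add_right, inner_smul_right, inner_smul_right, i₀] at h
    have : Real.sin θ * ⟪(p₀ : EuclideanSpace ℝ (Fin (n + 1))), e⟫ = 0 := by linarith
    exact (mul_eq_zero.1 this).resolve_left hsin.ne'
  have ie₁ : ⟪e, (p₀ : EuclideanSpace ℝ (Fin (n + 1)))⟫ = 0 := by rw [real_inner_comm, ie₀]
  have ie : ⟪e, e⟫ = 1 := by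
    have h := i₁
    rw [← he] at h
    simp only [inner_add_left, inner_add_right, real_inner_smul_left, real_inner_smul_right, i₀,
      ie₀, ie₁] at h
    have h3 := Real.sin_sq_add_cos_sq θ
    have : Real.sin θ ^ 2 * (⟪e, e⟫ - 1) = 0 := by linear_combination h - h3
    linarith [(mul_eq_zero.1 this).resolve_left (by positivity)]
  have ne : ‖e‖ = 1 := by
    rw [norm_eq_sqrt_real_inner, ie, Real.sqrt_one]
  obtain ⟨b, hb⟩ := Orthonormal.exists_orthonormalBasis_extension_of_card_eq (𝕜 := ℝ)
    (E := EuclideanSpace ℝ (Fin (n + 1))) (ι := Option (Option (Fin (n - 1))))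
    (by simp; omega)
    (v := fun i => i.elim (p₀ : EuclideanSpace ℝ (Fin (n + 1))) fun _ => e)
    (s := {none, some none}) (by
      refine ⟨?_, ?_⟩
      · rintro ⟨i, rfl | rfl⟩
        · exact n₀
        · exact ne
      · rintro ⟨i, rfl | rfl⟩ ⟨j, rfl | rfl⟩ h
        · exact (h rfl).elim
        · exact ie₀
        · exact ie₁
        · exact (h rfl).elim)
  have hb₀ : b none = p₀ := hb none (by simp)
  have hb₁ : b (some none) = e := hb (some none) (by simp)
  have hbo : ∀ i j, ⟪b i, b j⟫ = if i = j then 1 else 0 := orthonormal_iff_ite.1 b.orthonormal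
  have hcard : ((Fintype.card (Fin (n - 1)) : ℕ) : ℝ) + 1 = n := by
    rw [Fintype.card_fin, Nat.cast_sub (by omega)]; simp
  have : Nonempty (Fin (n - 1)) := ⟨⟨0, by omega⟩⟩
  have hKc : IsClosed {q : Metric.sphere (0 : EuclideanSpace ℝ (Fin (n + 1))) 1 |
      ⟪(p₀ : EuclideanSpace ℝ (Fin (n + 1))), (q : EuclideanSpace ℝ (Fin (n + 1)))⟫ ≤
        Real.cos a} := isClosed_le (by fun_prop) (by fun_prop)
  have key := setIntegral_rotation_eq (ι := Fin (n - 1)) (μ := sphereMeasure n) hKc.isCompact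
    hKc.measurableSet (x₀ := fun q => ⟪b none, (q : EuclideanSpace ℝ (Fin (n + 1)))⟫)
    (x₁ := fun q => ⟪b (some none), (q : EuclideanSpace ℝ (Fin (n + 1)))⟫)
    (z := fun i q => ⟪b (some (some i)), (q : EuclideanSpace ℝ (Fin (n + 1)))⟫)
    (by fun_prop) (by fun_prop) (fun i => by fun_prop) (fun q => by
      have := b.sum_sq_inner_right (q : EuclideanSpace ℝ (Fin (n + 1)))
      rw [Fintype.sum_option, Fintype.sum_option, norm_eq_of_mem_sphere, one_pow] at this
      linarith)
    ha (fun q hq => by rw [hb₀]; exact hq) h₁ h₂ hc (κ := κ) (by rw [hcard]; exact hode)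
    (fun φ ψ i => by
      have h := setIntegral_mul_inner_eq_zero (n := n) (p := p₀)
        (u := Real.cos φ • b none + Real.sin φ • (Real.cos ψ • b (some none) +
          Real.sin ψ • b (some (some i))))
        (f := -Real.sin ψ • b (some none) + Real.cos ψ • b (some (some i)))
        (by rw [← hb₀]; simp [inner_add_left, real_inner_smul_left, hbo])
        (by
          simp only [inner_add_left, inner_add_right, real_inner_smul_left,
            real_inner_smul_right, hbo]
          simp
          ring) (Real.cos a) H₁
      simpa only [inner_add_left, real_inner_smul_left] using h)
    (θ₀ := θ) ⟨hθ0.le, hp⟩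
  have hpq : ∀ q : EuclideanSpace ℝ (Fin (n + 1)), Real.cos θ * ⟪b none, q⟫ +
      Real.sin θ * ⟪b (some none), q⟫ = ⟪(p : EuclideanSpace ℝ (Fin (n + 1))), q⟫ := fun q => by
    rw [← he, hb₀, hb₁, inner_add_left, real_inner_smul_left, real_inner_smul_left]
  simp only [hpq] at key
  rw [key, hb₀, hcos]

theorem green_eq_greenSeries {n : ℕ} (hn : 2 ≤ n) (t : ℝ) :
    green n t = 2 / (n * sphereVol n) * greenSeries n (1 - t ^ 2 / 4) := by
  have h0 := incBeta_one hn 0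
  rw [Nat.cast_zero, add_zero] at h0
  rw [green, greenSeries]
  congr 1
  refine tsum_congr fun k => ?_
  have h1 := incBeta_one hn (k + 1)
  rw [Nat.cast_succ, ← add_assoc] at h1
  rw [h0, h1, div_div_div_cancel_right₀ (by positivity), greenMean, greenCoeff, div_div,
    mul_comm ((k : ℝ) + 1)]

theorem incBeta_sin_half_sq_zero {n : ℕ} (hn : 2 ≤ n) {b : ℝ} (hb : b ∈ Set.Icc 0 π) :
    incBeta (Real.sin (b / 2) ^ 2) ((n : ℝ) / 2) ((n : ℝ) / 2) =
      sinMoment n 0 b / 2 ^ (n - 1) := by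
  simpa using incBeta_sin_half_sq hn 0 hb

theorem Kfun_eq {n : ℕ} (hn : 2 ≤ n) {b : ℝ} (hb : b ∈ Set.Icc 0 π) :
    Kfun n b = 2 / (n * sphereVol n) * ∑' k : ℕ,
      greenCoeff n k / (k + 1) * (sinMoment n (k + 1) b / sinMoment n 0 b) := by
  rw [Kfun]
  congr 1
  refine tsum_congr fun k => ?_
  have h1 := incBeta_sin_half_sq hn (k + 1) hb
  rw [Nat.cast_succ, ← add_assoc] at h1
  rw [incBeta_sin_half_sq_zero hn hb, h1, div_div_div_cancel_right₀ (by positivity), greenCoeff,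
    div_div]

theorem ballVol_eq (n : ℕ) (a : ℝ) : ballVol n a = sphereVol (n - 1) * sinMoment n 0 a := by
  simp [ballVol, sinMoment]

instance (n : ℕ) : IsFiniteMeasure (sphereMeasure n) := by unfold sphereMeasure; infer_instance

theorem inner_sphere_mem_Icc {n : ℕ} (p q : Metric.sphere (0 : EuclideanSpace ℝ (Fin (n + 1))) 1) :
    ⟪(p : EuclideanSpace ℝ (Fin (n + 1))), (q : EuclideanSpace ℝ (Fin (n + 1)))⟫ ∈
      Set.Icc (-1 : ℝ) 1 := by
  have := abs_le.1 (abs_real_inner_le_norm (p : EuclideanSpace ℝ (Fin (n + 1)))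
    (q : EuclideanSpace ℝ (Fin (n + 1))))
  rwa [norm_eq_of_mem_sphere, norm_eq_of_mem_sphere, one_mul] at this

theorem le_arccos_inner_iff {n : ℕ} (p q : Metric.sphere (0 : EuclideanSpace ℝ (Fin (n + 1))) 1)
    {a : ℝ} (ha : a ∈ Set.Icc 0 π) :
    a ≤ Real.arccos ⟪(p : EuclideanSpace ℝ (Fin (n + 1))), (q : EuclideanSpace ℝ (Fin (n + 1)))⟫ ↔
      ⟪(p : EuclideanSpace ℝ (Fin (n + 1))), (q : EuclideanSpace ℝ (Fin (n + 1)))⟫ ≤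
        Real.cos a := by
  have h := inner_sphere_mem_Icc p q
  conv_rhs => rw [← Real.cos_arccos h.1 h.2]
  exact (Real.strictAntiOn_cos.le_iff_ge ⟨Real.arccos_nonneg _, Real.arccos_le_pi _⟩ ha).symm

theorem setIntegral_half_one_add_inner_pow {n : ℕ} (hn : 2 ≤ n)
    (p : Metric.sphere (0 : EuclideanSpace ℝ (Fin (n + 1))) 1) {a : ℝ} (ha : a ∈ Set.Ico 0 π)
    (m : ℕ) :
    ∫ q in {q : Metric.sphere (0 : EuclideanSpace ℝ (Fin (n + 1))) 1 |
        ⟪(p : EuclideanSpace ℝ (Fin (n + 1))), (q : EuclideanSpace ℝ (Fin (n + 1)))⟫ ≤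
          Real.cos a},
      ((1 + ⟪(p : EuclideanSpace ℝ (Fin (n + 1))), (q : EuclideanSpace ℝ (Fin (n + 1)))⟫) / 2) ^ m
        ∂(sphereMeasure n) = sphereVol (n - 1) * sinMoment n m (π - a) := by
  have h := setIntegral_arccos_inner_sphere hn p (measurableSet_Ici (a := a))
    (g := fun φ => ((1 + Real.cos φ) / 2) ^ m) (by fun_prop)
  simp only [Set.mem_Ici, le_arccos_inner_iff p _ ⟨ha.1, ha.2.le⟩,
    fun q => Real.cos_arccos (inner_sphere_mem_Icc p q).1 (inner_sphere_mem_Icc p q).2] at h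
  rw [h]
  congr 1
  have e : (Set.Ici a ∩ Set.Ioo 0 π : Set ℝ) =ᵐ[volume] Set.Ioc a π := by
    refine EventuallyEq.trans ?_ Ioo_ae_eq_Ioc
    have : (Set.Ici a ∩ Set.Ioo 0 π : Set ℝ) =ᵐ[volume] (Set.Ioi a ∩ Set.Ioo 0 π : Set ℝ) :=
      Ioi_ae_eq_Ici.symm.inter (ae_eq_refl _)
    rw [show (Set.Ioi a ∩ Set.Ioo 0 π : Set ℝ) = Set.Ioo a π by
      ext x
      exact ⟨fun h => ⟨h.1, h.2.2⟩, fun h => ⟨h.1, ha.1.trans_lt h.1, h.2⟩⟩] at this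
    exact this
  rw [setIntegral_congr_set e, ← intervalIntegral.integral_of_le ha.2.le, sinMoment]
  have h2 := intervalIntegral.integral_comp_sub_left (a := 0) (b := π - a)
    (fun φ => Real.sin φ ^ (n - 1) * ((1 + Real.cos φ) / 2) ^ m) π
  rw [sub_sub_cancel, sub_zero] at h2
  rw [← h2]
  refine intervalIntegral.integral_congr fun φ _ => ?_
  simp only [Real.sin_pi_sub, Real.cos_pi_sub]
  rw [Real.sin_sq_eq_half_sub, mul_div_cancel₀ _ two_ne_zero]
  ring

theorem measureReal_inner_le_cos {n : ℕ} (hn : 2 ≤ n)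
    (p : Metric.sphere (0 : EuclideanSpace ℝ (Fin (n + 1))) 1) {a : ℝ} (ha : a ∈ Set.Ico 0 π) :
    (sphereMeasure n).real {q : Metric.sphere (0 : EuclideanSpace ℝ (Fin (n + 1))) 1 |
        ⟪(p : EuclideanSpace ℝ (Fin (n + 1))), (q : EuclideanSpace ℝ (Fin (n + 1)))⟫ ≤
          Real.cos a} = sphereVol (n - 1) * sinMoment n 0 (π - a) := by
  simpa using setIntegral_half_one_add_inner_pow hn p ha 0

theorem integral_half_one_add_inner_pow {n : ℕ} (hn : 2 ≤ n)
    (p : Metric.sphere (0 : EuclideanSpace ℝ (Fin (n + 1))) 1) (k : ℕ) :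
    ∫ q : Metric.sphere (0 : EuclideanSpace ℝ (Fin (n + 1))) 1,
      ((1 + ⟪(p : EuclideanSpace ℝ (Fin (n + 1))),
        (q : EuclideanSpace ℝ (Fin (n + 1)))⟫) / 2) ^ (k + 1) ∂(sphereMeasure n) =
      (sphereMeasure n).real Set.univ * greenMean n k := by
  have e : {q : Metric.sphere (0 : EuclideanSpace ℝ (Fin (n + 1))) 1 |
      ⟪(p : EuclideanSpace ℝ (Fin (n + 1))), (q : EuclideanSpace ℝ (Fin (n + 1)))⟫ ≤
        Real.cos 0} = Set.univ :=
    Set.eq_univ_of_forall fun q => by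
      rw [Set.mem_ofPred_eq, Real.cos_zero]; exact (inner_sphere_mem_Icc p q).2
  have h0 := measureReal_inner_le_cos hn p ⟨le_rfl, Real.pi_pos⟩
  have h1 := setIntegral_half_one_add_inner_pow hn p ⟨le_rfl, Real.pi_pos⟩ (k + 1)
  have h2 := sinMoment_pos n 0 Real.pi_pos le_rfl
  rw [e, setIntegral_univ, sub_zero] at h1
  rw [e, sub_zero] at h0
  rw [h1, h0, greenMean]
  field_simp

theorem integrable_half_one_add_inner_pow {n : ℕ}
    (p : Metric.sphere (0 : EuclideanSpace ℝ (Fin (n + 1))) 1) (m : ℕ) :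
    Integrable (fun q : Metric.sphere (0 : EuclideanSpace ℝ (Fin (n + 1))) 1 =>
      ((1 + ⟪(p : EuclideanSpace ℝ (Fin (n + 1))), (q : EuclideanSpace ℝ (Fin (n + 1)))⟫) / 2) ^ m)
      (sphereMeasure n) := by
  have hc : Continuous fun q : Metric.sphere (0 : EuclideanSpace ℝ (Fin (n + 1))) 1 =>
      ((1 + ⟪(p : EuclideanSpace ℝ (Fin (n + 1))),
        (q : EuclideanSpace ℝ (Fin (n + 1)))⟫) / 2) ^ m := by fun_prop
  exact integrableOn_univ.1 (hc.continuousOn.integrableOn_compact isCompact_univ)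

theorem hasSum_setIntegral_greenSeries {n : ℕ} (hn : 2 ≤ n)
    (p : Metric.sphere (0 : EuclideanSpace ℝ (Fin (n + 1))) 1)
    (A : Set (Metric.sphere (0 : EuclideanSpace ℝ (Fin (n + 1))) 1)) :
    HasSum (fun k : ℕ => greenCoeff n k / (k + 1) * (∫ q in A,
      ((1 + ⟪(p : EuclideanSpace ℝ (Fin (n + 1))),
        (q : EuclideanSpace ℝ (Fin (n + 1)))⟫) / 2) ^ (k + 1) ∂(sphereMeasure n) -
          (sphereMeasure n).real A * greenMean n k))
      (∫ q in A, greenSeries n ((1 + ⟪(p : EuclideanSpace ℝ (Fin (n + 1))),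
        (q : EuclideanSpace ℝ (Fin (n + 1)))⟫) / 2) ∂(sphereMeasure n)) := by
  have hx : ∀ q : Metric.sphere (0 : EuclideanSpace ℝ (Fin (n + 1))) 1,
      0 ≤ (1 + ⟪(p : EuclideanSpace ℝ (Fin (n + 1))),
        (q : EuclideanSpace ℝ (Fin (n + 1)))⟫) / 2 := fun q => by
    linarith [(inner_sphere_mem_Icc p q).1]
  have hc : ∀ k : ℕ, 0 ≤ greenCoeff n k / (k + 1) := fun k => by
    have := greenCoeff_pos hn k
    positivity
  have hb : ∀ k, 0 ≤ greenMean n k := fun k =>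
    div_nonneg (sinMoment_pos n _ Real.pi_pos le_rfl).le (sinMoment_pos n _ Real.pi_pos le_rfl).le
  have hi : ∀ k, Integrable (fun q : Metric.sphere (0 : EuclideanSpace ℝ (Fin (n + 1))) 1 =>
      greenCoeff n k / (k + 1) * (((1 + ⟪(p : EuclideanSpace ℝ (Fin (n + 1))),
        (q : EuclideanSpace ℝ (Fin (n + 1)))⟫) / 2) ^ (k + 1) - greenMean n k))
      (sphereMeasure n) := fun k =>
    ((integrable_half_one_add_inner_pow p (k + 1)).sub (integrable_const _)).const_mul _
  have hi' : ∀ k, Integrable (fun q : Metric.sphere (0 : EuclideanSpace ℝ (Fin (n + 1))) 1 =>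
      greenCoeff n k / (k + 1) * (((1 + ⟪(p : EuclideanSpace ℝ (Fin (n + 1))),
        (q : EuclideanSpace ℝ (Fin (n + 1)))⟫) / 2) ^ (k + 1) + greenMean n k))
      (sphereMeasure n) := fun k =>
    ((integrable_half_one_add_inner_pow p (k + 1)).add (integrable_const _)).const_mul _
  have key := hasSum_integral_of_summable_integral_norm (fun k => (hi k).restrict (s := A)) (by
    refine Summable.of_nonneg_of_le (fun k => integral_nonneg fun q => norm_nonneg _) (fun k => ?_)
      ((summable_greenCoeff_mul_greenMean hn).mul_left
        (2 * (sphereMeasure n).real Set.univ))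
    calc _ ≤ ∫ q : Metric.sphere (0 : EuclideanSpace ℝ (Fin (n + 1))) 1,
          greenCoeff n k / (k + 1) * (((1 + ⟪(p : EuclideanSpace ℝ (Fin (n + 1))),
            (q : EuclideanSpace ℝ (Fin (n + 1)))⟫) / 2) ^ (k + 1) + greenMean n k)
            ∂(sphereMeasure n) := by
          refine (setIntegral_le_integral (hi k).norm
            (Eventually.of_forall fun q => norm_nonneg _)).trans ?_
          refine integral_mono (hi k).norm (hi' k) fun q => ?_
          have h1 : 0 ≤ ((1 + ⟪(p : EuclideanSpace ℝ (Fin (n + 1))),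
            (q : EuclideanSpace ℝ (Fin (n + 1)))⟫) / 2) ^ (k + 1) := pow_nonneg (hx q) _
          simp only [norm_mul, Real.norm_of_nonneg (hc k)]
          refine mul_le_mul_of_nonneg_left (abs_le.2 ⟨?_, ?_⟩) (hc k) <;> linarith [hb k]
      _ = _ := by
          rw [integral_const_mul, integral_add (integrable_half_one_add_inner_pow p (k + 1))
            (integrable_const _), integral_half_one_add_inner_pow hn, integral_const, smul_eq_mul]
          ring)
  have e : ∀ k : ℕ, ∫ q in A, greenCoeff n k / (k + 1) *
      (((1 + ⟪(p : EuclideanSpace ℝ (Fin (n + 1))),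
        (q : EuclideanSpace ℝ (Fin (n + 1)))⟫) / 2) ^ (k + 1) - greenMean n k)
        ∂(sphereMeasure n) = greenCoeff n k / (k + 1) * (∫ q in A,
      ((1 + ⟪(p : EuclideanSpace ℝ (Fin (n + 1))),
        (q : EuclideanSpace ℝ (Fin (n + 1)))⟫) / 2) ^ (k + 1) ∂(sphereMeasure n) -
          (sphereMeasure n).real A * greenMean n k) := fun k => by
    rw [integral_const_mul, integral_sub (integrable_half_one_add_inner_pow p (k + 1)).restrict
      (integrable_const _), setIntegral_const, smul_eq_mul]
  simp only [e] at key
  exact key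

theorem setIntegral_greenSeries_add_compl {n : ℕ} (hn : 2 ≤ n)
    (p : Metric.sphere (0 : EuclideanSpace ℝ (Fin (n + 1))) 1)
    {A : Set (Metric.sphere (0 : EuclideanSpace ℝ (Fin (n + 1))) 1)} (hA : MeasurableSet A) :
    (∫ q in A, greenSeries n ((1 + ⟪(p : EuclideanSpace ℝ (Fin (n + 1))),
        (q : EuclideanSpace ℝ (Fin (n + 1)))⟫) / 2) ∂(sphereMeasure n)) +
      ∫ q in Aᶜ, greenSeries n ((1 + ⟪(p : EuclideanSpace ℝ (Fin (n + 1))),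
        (q : EuclideanSpace ℝ (Fin (n + 1)))⟫) / 2) ∂(sphereMeasure n) = 0 := by
  refine ((hasSum_setIntegral_greenSeries hn p A).add
    (hasSum_setIntegral_greenSeries hn p Aᶜ)).unique ?_
  have e : ∀ k : ℕ, greenCoeff n k / (k + 1) * (∫ q in A,
      ((1 + ⟪(p : EuclideanSpace ℝ (Fin (n + 1))),
        (q : EuclideanSpace ℝ (Fin (n + 1)))⟫) / 2) ^ (k + 1) ∂(sphereMeasure n) -
          (sphereMeasure n).real A * greenMean n k) +
      greenCoeff n k / (k + 1) * (∫ q in Aᶜ,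
      ((1 + ⟪(p : EuclideanSpace ℝ (Fin (n + 1))),
        (q : EuclideanSpace ℝ (Fin (n + 1)))⟫) / 2) ^ (k + 1) ∂(sphereMeasure n) -
          (sphereMeasure n).real Aᶜ * greenMean n k) = 0 := fun k => by
    have h1 := integral_add_compl hA (integrable_half_one_add_inner_pow p (k + 1))
    rw [integral_half_one_add_inner_pow hn] at h1
    have h2 := measureReal_add_measureReal_compl (μ := sphereMeasure n) hA
    rw [← h2] at h1
    linear_combination (greenCoeff n k / (k + 1)) * h1
  simp only [e]
  exact hasSum_zero

theorem setIntegral_greenSeries_sub {n : ℕ} (hn : 2 ≤ n)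
    (p : Metric.sphere (0 : EuclideanSpace ℝ (Fin (n + 1))) 1) {a : ℝ} (ha : a ∈ Set.Ioo 0 π) :
    sphereVol (n - 1) * sinMoment n 0 (π - a) * (∑' k : ℕ, greenCoeff n k / (k + 1) *
      (sinMoment n (k + 1) (π - a) / sinMoment n 0 (π - a))) =
    ∫ q in {q : Metric.sphere (0 : EuclideanSpace ℝ (Fin (n + 1))) 1 |
        ⟪(p : EuclideanSpace ℝ (Fin (n + 1))), (q : EuclideanSpace ℝ (Fin (n + 1)))⟫ ≤
          Real.cos a}, greenSeries n ((1 + ⟪(p : EuclideanSpace ℝ (Fin (n + 1))),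
        (q : EuclideanSpace ℝ (Fin (n + 1)))⟫) / 2) ∂(sphereMeasure n) -
      sphereVol (n - 1) * sinMoment n 0 (π - a) * greenSeries n 0 := by
  have ha' : a ∈ Set.Ico 0 π := ⟨ha.1.le, ha.2⟩
  have h0 : HasSum (fun k : ℕ => -(greenCoeff n k / (k + 1) * greenMean n k))
      (greenSeries n 0) := by
    have := (summable_greenCoeff_mul_greenMean hn).neg.hasSum
    simpa [greenSeries] using this
  have h1 := (hasSum_setIntegral_greenSeries hn p
    {q : Metric.sphere (0 : EuclideanSpace ℝ (Fin (n + 1))) 1 |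
        ⟪(p : EuclideanSpace ℝ (Fin (n + 1))), (q : EuclideanSpace ℝ (Fin (n + 1)))⟫ ≤
          Real.cos a}).sub (h0.mul_left (sphereVol (n - 1) * sinMoment n 0 (π - a)))
  simp only [setIntegral_half_one_add_inner_pow hn p ha', measureReal_inner_le_cos hn p ha'] at h1
  rw [← tsum_mul_left, ← h1.tsum_eq]
  refine tsum_congr fun k => ?_
  have := sinMoment_pos n 0 (b := π - a) (by linarith [ha.2]) (by linarith [ha.1])
  field_simp
  ring

theorem setIntegral_compl_cap_greenSeries {n : ℕ} (hn : 2 ≤ n)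
    {p₀ p : Metric.sphere (0 : EuclideanSpace ℝ (Fin (n + 1))) 1} (hne : p ≠ p₀)
    {a : ℝ} (ha : a ∈ Set.Ioo 0 π)
    (hp : Real.arccos ⟪(p₀ : EuclideanSpace ℝ (Fin (n + 1))),
      (p : EuclideanSpace ℝ (Fin (n + 1)))⟫ < a) :
    ∫ q in {q : Metric.sphere (0 : EuclideanSpace ℝ (Fin (n + 1))) 1 |
        ⟪(p₀ : EuclideanSpace ℝ (Fin (n + 1))), (q : EuclideanSpace ℝ (Fin (n + 1)))⟫ ≤
          Real.cos a},
      greenSeries n ((1 + ⟪(p : EuclideanSpace ℝ (Fin (n + 1))),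
        (q : EuclideanSpace ℝ (Fin (n + 1)))⟫) / 2) ∂(sphereMeasure n) =
    ∫ q in {q : Metric.sphere (0 : EuclideanSpace ℝ (Fin (n + 1))) 1 |
        ⟪(p₀ : EuclideanSpace ℝ (Fin (n + 1))), (q : EuclideanSpace ℝ (Fin (n + 1)))⟫ ≤
          Real.cos a},
      greenSeries n ((1 + ⟪(p₀ : EuclideanSpace ℝ (Fin (n + 1))),
        (q : EuclideanSpace ℝ (Fin (n + 1)))⟫) / 2) ∂(sphereMeasure n) +
    sphereVol (n - 1) * sinMoment n 0 (π - a) *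
      (greenSeries n ((1 - ⟪(p₀ : EuclideanSpace ℝ (Fin (n + 1))),
        (p : EuclideanSpace ℝ (Fin (n + 1)))⟫) / 2) - greenSeries n 0) := by
  have hx : ∀ y ∈ Set.Ioo (-3 : ℝ) 1, |(1 + y) / 2| < 1 := fun y hy =>
    abs_lt.2 ⟨by linarith [hy.1], by linarith [hy.2]⟩
  have hd : ∀ y : ℝ, HasDerivAt (fun y : ℝ => (1 + y) / 2) (1 / 2) y := fun y =>
    ((hasDerivAt_id y).const_add 1).div_const 2
  have hcomp : ∀ {h : ℝ → ℝ} {h' y : ℝ}, HasDerivAt h h' ((1 + y) / 2) →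
      HasDerivAt (fun y => h ((1 + y) / 2)) (h' * (1 / 2)) y := fun {h} _ y hh =>
    HasDerivAt.comp (h₂ := h) (h := fun y : ℝ => (1 + y) / 2) y hh (hd y)
  have hs := fun r => summable_greenCoeff hn (r := r)
  have hs' := fun r => summable_succ_mul_pow hs (r := r)
  have key := setIntegral_compl_cap_eq hn hne ha hp (κ := (n : ℝ) / 2)
    (H := fun y => greenSeries n ((1 + y) / 2))
    (H₁ := fun y => (∑' k, greenCoeff n k * ((1 + y) / 2) ^ k) * (1 / 2))
    (H₂ := fun y => (∑' k : ℕ, (((k : ℝ) + 1) * greenCoeff n (k + 1)) * ((1 + y) / 2) ^ k) *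
      (1 / 2) * (1 / 2))
    (fun y hy => hcomp (hasDerivAt_greenSeries hn (hx y hy)))
    (fun y hy => (hcomp (hasDerivAt_tsum_mul_pow hs (hx y hy))).mul_const _)
    (fun y hy => (((hcomp (hasDerivAt_tsum_mul_pow hs' (hx y hy))).continuousAt.mul_const _).mul_const
      _).continuousWithinAt)
    (fun y hy => by
      have := greenSeries_ode hn (hx y hy)
      linear_combination this)
  rw [key, measureReal_inner_le_cos hn p₀ ⟨ha.1.le, ha.2⟩]
  norm_num [sub_eq_add_neg]

theorem stmt_14 (n : ℕ) (hn : 2 ≤ n)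
    (p₀ p : Metric.sphere (0 : EuclideanSpace ℝ (Fin (n + 1))) 1) (hne : p ≠ p₀)
    (a : ℝ) (ha : a ∈ Set.Ioo 0 π)
    (hp : Real.arccos ⟪(p₀ : EuclideanSpace ℝ (Fin (n + 1))), (p : EuclideanSpace ℝ (Fin (n + 1)))⟫ < a) :
    1 / ballVol n a *
        ∫ q in {q : Metric.sphere (0 : EuclideanSpace ℝ (Fin (n + 1))) 1 |
            Real.arccos ⟪(p₀ : EuclideanSpace ℝ (Fin (n + 1))), (q : EuclideanSpace ℝ (Fin (n + 1)))⟫ < a},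
          green n ‖(p : EuclideanSpace ℝ (Fin (n + 1))) - (q : EuclideanSpace ℝ (Fin (n + 1)))‖
            ∂(sphereMeasure n) =
      -(incBeta (Real.cos (a / 2) ^ 2) ((n : ℝ) / 2) ((n : ℝ) / 2) /
          incBeta (Real.sin (a / 2) ^ 2) ((n : ℝ) / 2) ((n : ℝ) / 2)) *
        (green n ‖(p : EuclideanSpace ℝ (Fin (n + 1))) + (p₀ : EuclideanSpace ℝ (Fin (n + 1)))‖
          + Kfun n (π - a)) := by
  have hπ : π - a ∈ Set.Ioo 0 π := ⟨by linarith [ha.2], by linarith [ha.1]⟩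
  have hB : {q : Metric.sphere (0 : EuclideanSpace ℝ (Fin (n + 1))) 1 |
      Real.arccos ⟪(p₀ : EuclideanSpace ℝ (Fin (n + 1))),
        (q : EuclideanSpace ℝ (Fin (n + 1)))⟫ < a} =
      {q : Metric.sphere (0 : EuclideanSpace ℝ (Fin (n + 1))) 1 |
        ⟪(p₀ : EuclideanSpace ℝ (Fin (n + 1))), (q : EuclideanSpace ℝ (Fin (n + 1)))⟫ ≤
          Real.cos a}ᶜ := by
    ext q
    exact not_le.symm.trans (not_congr (le_arccos_inner_iff p₀ q ⟨ha.1.le, ha.2.le⟩))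
  have hm : MeasurableSet {q : Metric.sphere (0 : EuclideanSpace ℝ (Fin (n + 1))) 1 |
      ⟪(p₀ : EuclideanSpace ℝ (Fin (n + 1))), (q : EuclideanSpace ℝ (Fin (n + 1)))⟫ ≤
        Real.cos a} := (isClosed_le (by fun_prop) continuous_const).measurableSet
  have hg : ∀ q : Metric.sphere (0 : EuclideanSpace ℝ (Fin (n + 1))) 1,
      green n ‖(p : EuclideanSpace ℝ (Fin (n + 1))) - (q : EuclideanSpace ℝ (Fin (n + 1)))‖ =
        2 / (n * sphereVol n) * greenSeries n ((1 + ⟪(p : EuclideanSpace ℝ (Fin (n + 1))),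
          (q : EuclideanSpace ℝ (Fin (n + 1)))⟫) / 2) := fun q => by
    rw [green_eq_greenSeries hn, norm_sub_sq_real, norm_eq_of_mem_sphere, norm_eq_of_mem_sphere]
    congr 2
    ring
  have hg₀ : green n
      ‖(p : EuclideanSpace ℝ (Fin (n + 1))) + (p₀ : EuclideanSpace ℝ (Fin (n + 1)))‖ =
        2 / (n * sphereVol n) * greenSeries n ((1 - ⟪(p₀ : EuclideanSpace ℝ (Fin (n + 1))),
          (p : EuclideanSpace ℝ (Fin (n + 1)))⟫) / 2) := by
    rw [green_eq_greenSeries hn, norm_add_sq_real, norm_eq_of_mem_sphere, norm_eq_of_mem_sphere,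
      real_inner_comm]
    congr 2
    ring
  have hcs : Real.cos (a / 2) = Real.sin ((π - a) / 2) := by
    rw [← Real.sin_pi_div_two_sub]
    ring_nf
  simp only [hg]
  rw [hB, integral_const_mul, hg₀, Kfun_eq hn ⟨hπ.1.le, hπ.2.le⟩, ballVol_eq, hcs,
    incBeta_sin_half_sq_zero hn ⟨hπ.1.le, hπ.2.le⟩, incBeta_sin_half_sq_zero hn ⟨ha.1.le, ha.2.le⟩,
    div_div_div_cancel_right₀ (by positivity)]
  have h1 := setIntegral_greenSeries_add_compl hn p hm
  have h2 := setIntegral_compl_cap_greenSeries hn hne ha hp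
  have h3 := setIntegral_greenSeries_sub hn p₀ ha
  have h4 := sinMoment_pos n 0 ha.1 ha.2.le
  have h5 := sphereVol_pos (n - 1)
  rw [eq_neg_of_add_eq_zero_right h1, h2, sub_eq_iff_eq_add.1 h3.symm]
  generalize (∑' k : ℕ, greenCoeff n k / ((k : ℝ) + 1) *
    (sinMoment n (k + 1) (π - a) / sinMoment n 0 (π - a))) = S
  field_simp
  ring
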